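/- arXiv:1410.4480 — 4 statements merged into one kernel-verified Lean document; each statement's English description precedes it below -/
import Mathlib

section
/- Set δᵢ = −3·(−9 + 6√3)^{1/3}/4^{1/3}, let δ ∈ (δᵢ, 0), and let b₀ be the smallest positive root of b⁶ − 4b³ − δb² + 1. Define f(x,y) = 1 + b₀²x² + 2xy − y²/b₀². With P(x,y) = y, Q(x,y) = −x³ + δx²y + y³, and ḟ = P·∂f/∂x + Q·∂f/∂y, the set C = {(x,y) ∈ ℝ² : f(x,y) = 0} is nonempty (a hyperbola), ḟ does not take both strictly positive and strictly negative values on C, and {p ∈ C : ḟ(p) = 0} is finite. -/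
theorem Real.finite_setOf_sq_eq (m : ℝ) : {t : ℝ | t ^ 2 = m}.Finite := by
  refine Set.Finite.subset (Set.toFinite {√m, -√m}) ?_
  rintro t rfl
  rw [Real.sqrt_sq_eq_abs]
  rcases abs_choice t with h | h <;> simp [h]

/-- The total derivative of `1 + b²x² + 2xy - y²/b²`. -/
theorem hasFDerivAt_hyperbola (b x y : ℝ) :
    HasFDerivAt (fun p : ℝ × ℝ => 1 + b ^ 2 * p.1 ^ 2 + 2 * p.1 * p.2 - p.2 ^ 2 / b ^ 2)
      ((2 * b ^ 2 * x + 2 * y) • ContinuousLinearMap.fst ℝ ℝ ℝ +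
        (2 * x - 2 * y / b ^ 2) • ContinuousLinearMap.snd ℝ ℝ ℝ) (x, y) := by
  have h₁ : HasFDerivAt (fun p : ℝ × ℝ => p.1) (ContinuousLinearMap.fst ℝ ℝ ℝ) (x, y) :=
    hasFDerivAt_fst
  have h₂ : HasFDerivAt (fun p : ℝ × ℝ => p.2) (ContinuousLinearMap.snd ℝ ℝ ℝ) (x, y) :=
    hasFDerivAt_snd
  have h := ((((h₁.pow 2).const_mul (b ^ 2)).const_add 1).add
    ((h₁.const_mul 2).mul h₂)).sub ((h₂.pow 2).const_mul (b ^ 2)⁻¹)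
  refine (h.congr_fderiv ?_).congr_of_eventuallyEq (.of_forall fun p => ?_)
  · ext <;> simp <;> ring
  · simp only [Pi.add_apply, Pi.sub_apply, Pi.mul_apply]
    ring

/-- On the hyperbola, the derivative along the vector field is minus twice a perfect square. -/
theorem hyperbola_derivative_eq {δ b x y : ℝ} (hb : b ≠ 0)
    (hroot : b ^ 6 - 4 * b ^ 3 - δ * b ^ 2 + 1 = 0)
    (hxy : 1 + b ^ 2 * x ^ 2 + 2 * x * y - y ^ 2 / b ^ 2 = 0) :
    y * (2 * b ^ 2 * x + 2 * y) +
        (-x ^ 3 + δ * x ^ 2 * y + y ^ 3) * (2 * x - 2 * y / b ^ 2) =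
      -2 * (x * ((2 * b ^ 3 - 1) * (y / b ^ 2) + x)) ^ 2 := by
  obtain ⟨w, rfl⟩ : ∃ w, y = b ^ 2 * w := ⟨y / b ^ 2, by field_simp⟩
  have e₁ : b ^ 2 * w / b ^ 2 = w := by field_simp
  have e₂ : 2 * (b ^ 2 * w) / b ^ 2 = 2 * w := by field_simp
  have e₃ : (b ^ 2 * w) ^ 2 / b ^ 2 = b ^ 2 * w ^ 2 := by field_simp
  rw [e₃] at hxy
  rw [e₁, e₂]
  linear_combination (2 * b ^ 4 * w * (x + w)) * hxy - 2 * x ^ 2 * w * (x - w) * hroot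

/-- For `δ ∈ (δᵢ, 0)` with `δᵢ = -3·(-9 + 6√3)^(1/3)/4^(1/3)` and `b₀` the smallest
positive root of `b⁶ - 4b³ - δb² + 1`, the hyperbola `1 + b₀²x² + 2xy - y²/b₀² = 0`
is a nonempty transversal curve for the quasi-homogeneous system
`ẋ = y, ẏ = -x³ + δx²y + y³`. -/
theorem quasi_homogeneous_hyperbola_transversal
    (δ b₀ : ℝ)
    (hl : -3 * (-9 + 6 * Real.sqrt 3) ^ ((1 : ℝ) / 3) / (4 : ℝ) ^ ((1 : ℝ) / 3) < δ)
    (hr : δ < 0)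
    (hb₀pos : 0 < b₀)
    (hb₀root : b₀ ^ 6 - 4 * b₀ ^ 3 - δ * b₀ ^ 2 + 1 = 0)
    (hb₀min : ∀ b : ℝ, 0 < b → b ^ 6 - 4 * b ^ 3 - δ * b ^ 2 + 1 = 0 → b₀ ≤ b)
    (f fdot P Q : ℝ × ℝ → ℝ)
    (hf : ∀ x y : ℝ, f (x, y) = 1 + b₀ ^ 2 * x ^ 2 + 2 * x * y - y ^ 2 / b₀ ^ 2)
    (hP : ∀ x y : ℝ, P (x, y) = y)
    (hQ : ∀ x y : ℝ, Q (x, y) = -x ^ 3 + δ * x ^ 2 * y + y ^ 3)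
    (hfdot : ∀ p : ℝ × ℝ,
      fdot p = P p * fderiv ℝ f p (1, 0) + Q p * fderiv ℝ f p (0, 1)) :
    ({p : ℝ × ℝ | f p = 0}).Nonempty ∧
    ¬ ((∃ p : ℝ × ℝ, f p = 0 ∧ 0 < fdot p) ∧ (∃ p : ℝ × ℝ, f p = 0 ∧ fdot p < 0)) ∧
    Set.Finite {p : ℝ × ℝ | f p = 0 ∧ fdot p = 0} := by
  have hb : b₀ ≠ 0 := hb₀pos.ne'
  have hf_eq : f =
      fun p : ℝ × ℝ => 1 + b₀ ^ 2 * p.1 ^ 2 + 2 * p.1 * p.2 - p.2 ^ 2 / b₀ ^ 2 :=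
    funext fun p => hf p.1 p.2
  have hfdot_eq : ∀ x y : ℝ, f (x, y) = 0 →
      fdot (x, y) = -2 * (x * ((2 * b₀ ^ 3 - 1) * (y / b₀ ^ 2) + x)) ^ 2 := by
    intro x y hxy
    rw [hf] at hxy
    rw [← hyperbola_derivative_eq hb hb₀root hxy, hfdot, hP, hQ, hf_eq,
      (hasFDerivAt_hyperbola b₀ x y).fderiv]
    simp
  refine ⟨⟨(0, b₀), ?_⟩, ?_, ?_⟩
  · simp [hf, hb]
  · rintro ⟨⟨⟨x, y⟩, hxy, hpos⟩, -⟩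
    rw [hfdot_eq x y hxy] at hpos
    linarith [sq_nonneg (x * ((2 * b₀ ^ 3 - 1) * (y / b₀ ^ 2) + x))]
  · set k : ℝ := 2 * b₀ ^ 3 - 1 with hk
    set K : ℝ := 1 + 2 * k - k ^ 2 with hK
    refine Set.Finite.subset
      (((Real.finite_setOf_sq_eq (b₀ ^ 2)).image fun y => ((0 : ℝ), y)).union
        ((Real.finite_setOf_sq_eq (b₀ ^ 2 * K)⁻¹).image fun w => (-k * w, b₀ ^ 2 * w))) ?_
    rintro ⟨x, y⟩ ⟨hxy, hzero⟩
    rw [hfdot_eq x y hxy] at hzero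
    rw [hf] at hxy
    have hprod : x * (k * (y / b₀ ^ 2) + x) = 0 := by simpa using hzero
    rcases mul_eq_zero.mp hprod with rfl | hx
    · refine Or.inl ⟨y, ?_, rfl⟩
      field_simp at hxy
      simp only [Set.mem_ofPred_eq]
      linarith
    · obtain ⟨w, rfl⟩ : ∃ w, y = b₀ ^ 2 * w := ⟨y / b₀ ^ 2, by field_simp⟩
      have e₁ : b₀ ^ 2 * w / b₀ ^ 2 = w := by field_simp
      have e₂ : (b₀ ^ 2 * w) ^ 2 / b₀ ^ 2 = b₀ ^ 2 * w ^ 2 := by field_simp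
      rw [e₁] at hx
      rw [e₂] at hxy
      obtain rfl : x = -k * w := by linarith
      refine Or.inr ⟨w, ?_, rfl⟩
      refine eq_inv_of_mul_eq_one_left ?_
      rw [hK]
      linear_combination -hxy
end

section
/- Set δᵢ = −3·(−9 + 6√3)^{1/3}/4^{1/3}. For each δ ∈ (δᵢ, 0), the system ẋ = y, ẏ = −x³ + δx²y + y³ has at least one nonconstant periodic solution: there exist a nonconstant differentiable γ : ℝ → ℝ² and T > 0 with γ'(t) = (γ₂(t), −γ₁(t)³ + δγ₁(t)²γ₂(t) + γ₂(t)³) and γ(t+T) = γ(t) for all t. -/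
open Set Filter Topology Metric NNReal

section GlobalFlow

variable {E : Type*} [NormedAddCommGroup E] [NormedSpace ℝ E]

/-- A bounded Lipschitz vector field on a Banach space has global integral curves. -/
theorem LipschitzWith.exists_hasDerivAt_of_bounded [CompleteSpace E] {v : E → E} {K L : ℝ≥0}
    (hv : LipschitzWith K v) (hb : ∀ x, ‖v x‖ ≤ L) (x₀ : E) :
    ∃ α : ℝ → E, α 0 = x₀ ∧ ∀ t, HasDerivAt α (v (α t)) t := by
  have hloc (n : ℕ) : ∃ α : ℝ → E, α 0 = x₀ ∧
      ∀ t ∈ Ioo (-(n + 1 : ℝ)) (n + 1), HasDerivAt α (v (α t)) t := by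
    have h0 : (0 : ℝ) ∈ Icc (-(n + 1 : ℝ)) (n + 1) := ⟨by linarith, by linarith⟩
    have hpl : IsPicardLindelof (fun _ ↦ v) (⟨0, h0⟩ : Icc (-(n + 1 : ℝ)) (n + 1)) x₀
        (L * (n + 1)) 0 L K :=
      .of_time_independent (fun x _ ↦ hb x) hv.lipschitzOnWith (by simp)
    obtain ⟨α, h0, hα⟩ := hpl.exists_eq_forall_mem_Icc_hasDerivWithinAt₀
    exact ⟨α, h0, fun t ht ↦
      (hα t (Ioo_subset_Icc_self ht)).hasDerivAt (Icc_mem_nhds ht.1 ht.2)⟩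
  choose α hα0 hα using hloc
  have hagree (m n : ℕ) (hmn : m ≤ n) : EqOn (α m) (α n) (Ioo (-(m + 1 : ℝ)) (m + 1)) := by
    have hmn' : (m : ℝ) ≤ n := mod_cast hmn
    refine ODE_solution_unique_of_mem_Ioo (v := fun _ ↦ v) (s := fun _ ↦ univ) (t₀ := 0) (K := K)
      (fun _ _ ↦ hv.lipschitzOnWith) ⟨by linarith, by linarith⟩ (fun t ht ↦ ⟨hα m t ht, trivial⟩)
      (fun t ht ↦ ⟨hα n t ⟨by linarith [ht.1], by linarith [ht.2]⟩, trivial⟩)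
      (by rw [hα0, hα0])
  have hmem (t : ℝ) {n : ℕ} (hn : ⌈|t|⌉₊ ≤ n) : t ∈ Ioo (-(n + 1 : ℝ)) (n + 1) := by
    have : |t| ≤ n := (Nat.le_ceil _).trans (mod_cast hn)
    constructor <;> linarith [abs_le.1 this]
  refine ⟨fun t ↦ α ⌈|t|⌉₊ t, hα0 _, fun t ↦ ?_⟩
  set n := ⌈|t|⌉₊
  refine (hα n t (hmem t le_rfl)).congr_of_eventuallyEq ?_
  filter_upwards [Ioo_mem_nhds (hmem t le_rfl).1 (hmem t le_rfl).2] with t' ht'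
  rcases le_total n ⌈|t'|⌉₊ with h | h
  · exact (hagree _ _ h ht').symm
  · exact hagree _ _ h (hmem t' le_rfl)

theorem LipschitzWith.dist_integralCurve_le {v : E → E} {K : ℝ≥0} (hv : LipschitzWith K v)
    {α β : ℝ → E} (hα : ∀ t, HasDerivAt α (v (α t)) t) (hβ : ∀ t, HasDerivAt β (v (β t)) t)
    (t : ℝ) : dist (α t) (β t) ≤ dist (α 0) (β 0) * Real.exp (K * |t|) := by
  have key {w : E → E} (hw : LipschitzWith K w) {α β : ℝ → E}
      (hα : ∀ t, HasDerivAt α (w (α t)) t) (hβ : ∀ t, HasDerivAt β (w (β t)) t) {t : ℝ}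
      (ht : 0 ≤ t) : dist (α t) (β t) ≤ dist (α 0) (β 0) * Real.exp (K * t) := by
    simpa using dist_le_of_trajectories_ODE (v := fun _ ↦ w) (fun _ ↦ hw)
      (HasDerivAt.continuousOn fun t _ ↦ hα t) (fun t _ ↦ (hα t).hasDerivWithinAt)
      (HasDerivAt.continuousOn fun t _ ↦ hβ t) (fun t _ ↦ (hβ t).hasDerivWithinAt)
      le_rfl t ⟨ht, le_rfl⟩
  rcases le_total 0 t with ht | ht
  · rw [abs_of_nonneg ht]
    exact key hv hα hβ ht
  · have hrev {α : ℝ → E} (hα : ∀ t, HasDerivAt α (v (α t)) t) (s : ℝ) :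
        HasDerivAt (fun s ↦ α (-s)) ((-v) (α (-s))) s := by
      simpa [Function.comp_def] using (hα (-s)).scomp s (hasDerivAt_neg s)
    simpa [abs_of_nonpos ht] using key hv.neg (hrev hα) (hrev hβ) (neg_nonneg.2 ht)

theorem LipschitzWith.integralCurve_unique {v : E → E} {K : ℝ≥0} (hv : LipschitzWith K v)
    {α β : ℝ → E} (hα : ∀ t, HasDerivAt α (v (α t)) t) (hβ : ∀ t, HasDerivAt β (v (β t)) t)
    {t₀ : ℝ} (h : α t₀ = β t₀) : α = β :=
  ODE_solution_unique_univ (v := fun _ ↦ v) (s := fun _ ↦ univ) (fun _ ↦ hv.lipschitzOnWith)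
    (fun t ↦ ⟨hα t, trivial⟩) (fun t ↦ ⟨hβ t, trivial⟩) h

theorem LipschitzWith.continuous_flow {X : Type*} [TopologicalSpace X] {v : E → E} {K : ℝ≥0}
    (hv : LipschitzWith K v) {Φ : X → ℝ → E}
    (hΦ : ∀ x t, HasDerivAt (Φ x) (v (Φ x t)) t) (h0 : Continuous fun x ↦ Φ x 0) :
    Continuous fun p : X × ℝ ↦ Φ p.1 p.2 := by
  refine continuous_iff_continuousAt.2 fun ⟨x, t⟩ ↦ tendsto_iff_dist_tendsto_zero.2 ?_
  have hlim : Tendsto (fun p : X × ℝ ↦ dist (Φ p.1 0) (Φ x 0) * Real.exp (K * |p.2|) +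
      dist (Φ x p.2) (Φ x t)) (𝓝 (x, t)) (𝓝 0) := by
    have hx : Continuous (Φ x) := continuous_iff_continuousAt.2 fun s ↦ (hΦ x s).continuousAt
    have : Continuous fun p : X × ℝ ↦ dist (Φ p.1 0) (Φ x 0) * Real.exp (K * |p.2|) +
        dist (Φ x p.2) (Φ x t) := by fun_prop
    exact this.tendsto' _ _ (by simp)
  refine squeeze_zero (fun _ ↦ dist_nonneg) (fun p ↦ ?_) hlim
  exact (dist_triangle _ (Φ x p.2) _).trans
    (by gcongr; exact hv.dist_integralCurve_le (hΦ _) (hΦ _) _)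

end GlobalFlow

section RealFunctions

variable {f : ℝ → ℝ} {f' a b τ : ℝ}

/-- A continuous function positive at `a` and nonpositive at `b` has a first zero in between. -/
lemma exists_first_zero (hf : Continuous f) (hab : a ≤ b) (ha : 0 < f a) (hb : f b ≤ 0) :
    ∃ τ ∈ Ioc a b, f τ = 0 ∧ ∀ t ∈ Ico a τ, 0 < f t := by
  set S := Icc a b ∩ f ⁻¹' Iic 0
  have hS : IsCompact S := isCompact_Icc.inter_right (isClosed_Iic.preimage hf)
  obtain ⟨hτ, hτ0⟩ : sInf S ∈ S := hS.sInf_mem ⟨b, ⟨hab, le_rfl⟩, hb⟩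
  have hpos : ∀ t ∈ Ico a (sInf S), 0 < f t := fun t ht ↦ by
    by_contra! h
    exact ht.2.not_ge (csInf_le hS.bddBelow ⟨⟨ht.1, ht.2.le.trans hτ.2⟩, h⟩)
  have hlt : a < sInf S := hτ.1.lt_of_ne fun h ↦ ha.not_ge (h ▸ hτ0)
  refine ⟨sInf S, ⟨hlt, hτ.2⟩, le_antisymm hτ0 ?_, hpos⟩
  exact ge_of_tendsto (hf.continuousAt.tendsto.mono_left nhdsWithin_le_nhds)
    (by filter_upwards [Ico_mem_nhdsLT hlt] with t ht using (hpos t ht).le)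

lemma HasDerivAt.eventually_pos_right (hf : HasDerivAt f f' a) (h0 : f a = 0) (h : 0 < f') :
    ∀ᶠ t in 𝓝[>] a, 0 < f t := by
  have hs := (hasDerivAt_iff_tendsto_slope.1 hf).eventually (lt_mem_nhds h)
  filter_upwards [nhdsWithin_mono a (fun t (ht : a < t) ↦ ht.ne') hs, self_mem_nhdsWithin]
    with t ht hat
  rw [slope_def_field, h0, sub_zero] at ht
  exact (div_pos_iff_of_pos_right (sub_pos.2 hat)).1 ht

lemma HasDerivAt.eventually_neg_left (hf : HasDerivAt f f' a) (h0 : f a = 0) (h : 0 < f') :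
    ∀ᶠ t in 𝓝[<] a, f t < 0 := by
  have hs := (hasDerivAt_iff_tendsto_slope.1 hf).eventually (lt_mem_nhds h)
  filter_upwards [nhdsWithin_mono a (fun t (ht : t < a) ↦ ht.ne) hs, self_mem_nhdsWithin]
    with t ht hat
  rw [slope_def_field, h0, sub_zero] at ht
  by_contra! hft
  exact ht.not_ge (div_nonpos_of_nonneg_of_nonpos hft (sub_nonpos.2 (le_of_lt hat)))

/-- A function which increases at each of its zeros stays positive. -/
lemma pos_of_deriv_pos_at_zeros {f' : ℝ → ℝ} (hf : ∀ t, HasDerivAt f (f' t) t) (h0 : 0 ≤ f a)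
    (h : ∀ t ∈ Ico a b, f t = 0 → 0 < f' t) : ∀ t ∈ Ioo a b, 0 < f t := by
  intro t ht
  by_contra! hft
  have hcont : Continuous f := continuous_iff_continuousAt.2 fun s ↦ (hf s).continuousAt
  have hright : ∀ᶠ s in 𝓝[>] a, 0 < f s := by
    rcases h0.eq_or_lt with h0 | h0
    · exact (hf a).eventually_pos_right h0.symm (h a ⟨le_rfl, ht.1.trans ht.2⟩ h0.symm)
    · exact nhdsWithin_le_nhds (hcont.continuousAt.eventually (lt_mem_nhds h0))
  obtain ⟨s, hs, has, hst⟩ := (hright.and (Ioo_mem_nhdsGT ht.1)).exists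
  obtain ⟨τ, hτ, hτ0, hpos⟩ := exists_first_zero hcont hst.le hs hft
  have hd := h τ ⟨(has.trans hτ.1).le, hτ.2.trans_lt ht.2⟩ hτ0
  obtain ⟨r, hr, hr'⟩ :=
    (((hf τ).eventually_neg_left hτ0 hd).and (Ico_mem_nhdsLT hτ.1)).exists
  exact hr.not_gt (hpos r hr')

/-- Continuity of the first hitting time of a transversally crossed zero. -/
lemma continuousOn_hittingTime {X : Type*} [TopologicalSpace X] {S : Set X} {G : X → ℝ → ℝ}
    {τ : X → ℝ} (hG : Continuous fun p : X × ℝ ↦ G p.1 p.2)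
    (hτ : ∀ x ∈ S, 0 < τ x) (hzero : ∀ x ∈ S, G x (τ x) = 0)
    (hpos : ∀ x ∈ S, ∀ t ∈ Ico 0 (τ x), 0 < G x t)
    (hneg : ∀ x ∈ S, ∀ᶠ t in 𝓝[>] τ x, G x t < 0) : ContinuousOn τ S := by
  intro x hx
  refine (nhds_basis_Ioo (τ x)).tendsto_right_iff.2 fun ⟨l, r⟩ ⟨hl, hr⟩ ↦ ?_
  have hlow : ∀ᶠ x' in 𝓝 x, ∀ t ∈ Icc 0 (max 0 l), 0 < G x' t := by
    refine isCompact_Icc.eventually_forall_of_forall_eventually fun t ht ↦ ?_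
    exact hG.continuousAt.eventually
      (lt_mem_nhds (hpos x hx t ⟨ht.1, ht.2.trans_lt (max_lt (hτ x hx) hl)⟩))
  obtain ⟨u, hu, hτu, hur⟩ := ((hneg x hx).and (Ioo_mem_nhdsGT hr)).exists
  have hhigh : ∀ᶠ x' in 𝓝 x, G x' u < 0 :=
    (by fun_prop : Continuous fun x' ↦ G x' u).continuousAt.eventually (gt_mem_nhds hu)
  filter_upwards [nhdsWithin_le_nhds hlow, nhdsWithin_le_nhds hhigh, self_mem_nhdsWithin]
    with x' h₁ h₂ hx'
  constructor
  · by_contra! h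
    exact (h₁ (τ x') ⟨(hτ x' hx').le, h.trans (le_max_right _ _)⟩).ne' (hzero x' hx')
  · by_contra! h
    exact h₂.not_gt (hpos x' hx' u ⟨((hτ x hx).trans hτu).le, hur.trans_le h⟩)

end RealFunctions
/-- A cubic whose graph `y ^ 2 = barrier x` is crossed transversally by the flow. -/
noncomputable def barrier (x : ℝ) : ℝ := (x + 57 / 20) * (39 * x ^ 2 + 37 * x + 30) / 100

/-- Half the derivative of `barrier`. -/
noncomputable def barrierSlope (x : ℝ) : ℝ :=
  (39 * x ^ 2 + 37 * x + 30 + (x + 57 / 20) * (78 * x + 37)) / 200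

lemma barrier_sq_gap_pos_left {x : ℝ} (hl : -(57 / 20) ≤ x) (hr : x ≤ -(3 / 2)) :
    0 < (x ^ 3 + barrierSlope x) ^ 2 - barrier x * (barrier x - 2111 / 1000 * x ^ 2) ^ 2 := by
  obtain ⟨u, rfl⟩ : ∃ u, x = -57 / 20 + u := ⟨x - (-57 / 20), by ring⟩
  obtain ⟨v, hv⟩ : ∃ v, v = 27 / 20 - u := ⟨_, rfl⟩
  have hu : 0 ≤ u := by linarith
  have hv0 : 0 ≤ v := by linarith
  refine lt_of_lt_of_eq (b := 1 / 10 +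
      (246462851936080000000 * v ^ 9 + 1044808649088565127292 * u * v ^ 8 +
        1908906823690626247668 * u ^ 2 * v ^ 7 + 1955006510696624393463 * u ^ 3 * v ^ 6 +
        1221900912197986384440 * u ^ 4 * v ^ 5 + 475115981328911893500 * u ^ 5 * v ^ 4 +
        112034604613585296000 * u ^ 6 * v ^ 3 + 14846777494629570000 * u ^ 7 * v ^ 2 +
        947281610790000000 * u ^ 8 * v + 22212623125000000 * u ^ 9) /
        7625597484987000000) (by positivity) ?_
  rw [hv]
  simp only [barrier, barrierSlope]
  ring

lemma barrier_sq_gap_pos_midleft {x : ℝ} (hl : -(3 / 2) ≤ x) (hr : x ≤ -(121 / 250)) :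
    0 < (x ^ 3 + barrierSlope x) ^ 2 - barrier x * (barrier x - 2111 / 1000 * x ^ 2) ^ 2 := by
  obtain ⟨u, rfl⟩ : ∃ u, x = -3 / 2 + u := ⟨x - (-3 / 2), by ring⟩
  obtain ⟨v, hv⟩ : ∃ v, v = 127 / 125 - u := ⟨_, rfl⟩
  have hu : 0 ≤ u := by linarith
  have hv0 : 0 ≤ v := by linarith
  refine lt_of_lt_of_eq (b := 1 / 5000 +
      (4369629807770252227783203125 * v ^ 9 + 5801223837053775787353515625 * u * v ^ 8 +
        161483302317158233642578125000 * u ^ 2 * v ^ 7 +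
        502520122581000926269531250000 * u ^ 3 * v ^ 6 +
        630482611364465989807128906250 * u ^ 4 * v ^ 5 +
        393398588607790526712972656250 * u ^ 5 * v ^ 4 +
        126797116859148355303103000000 * u ^ 6 * v ^ 3 +
        21490686757343520529539835000 * u ^ 7 * v ^ 2 + 2167158698367522368562861625 * u ^ 8 * v +
        924339325015512890167637 * u ^ 9) /
        35204115450304093745152000000) (by positivity) ?_
  rw [hv]
  simp only [barrier, barrierSlope]
  ring

lemma barrier_sq_gap_pos_midright {x : ℝ} (hl : -(119 / 250) ≤ x) (hr : x ≤ 3 / 2) :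
    0 < barrier x * (barrier x - 2111 / 1000 * x ^ 2) ^ 2 - (x ^ 3 + barrierSlope x) ^ 2 := by
  obtain ⟨u, rfl⟩ : ∃ u, x = -119 / 250 + u := ⟨x - (-119 / 250), by ring⟩
  obtain ⟨v, hv⟩ : ∃ v, v = 247 / 125 - u := ⟨_, rfl⟩
  have hu : 0 ≤ u := by linarith
  have hv0 : 0 ≤ v := by linarith
  refine lt_of_lt_of_eq (b := 3 / 10000 +
      (44170912641981987951159 * v ^ 9 + 314549103112266236358081875 * u * v ^ 8 +
        1554674243251575029868695000 * u ^ 2 * v ^ 7 +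
        23650312848058684607032750000 * u ^ 3 * v ^ 6 +
        166409570144485850479980468750 * u ^ 4 * v ^ 5 +
        433544828784756409890136718750 * u ^ 5 * v ^ 4 +
        469824865345294738281250000000 * u ^ 6 * v ^ 3 +
        251883015491409820556640625000 * u ^ 7 * v ^ 2 +
        9765381518550395965576171875 * u ^ 8 * v + 2118079873502254486083984375 * u ^ 9) /
        1078174795231616076427264000000) (by positivity) ?_
  rw [hv]
  simp only [barrier, barrierSlope]
  ring

lemma barrier_sq_gap_pos_right {x : ℝ} (hl : 3 / 2 ≤ x) (hr : x ≤ 3) :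
    0 < barrier x * (barrier x - 2111 / 1000 * x ^ 2) ^ 2 - (x ^ 3 + barrierSlope x) ^ 2 := by
  obtain ⟨u, rfl⟩ : ∃ u, x = 3 / 2 + u := ⟨x - 3 / 2, by ring⟩
  obtain ⟨v, hv⟩ : ∃ v, v = 3 / 2 - u := ⟨_, rfl⟩
  have hu : 0 ≤ u := by linarith
  have hv0 : 0 ≤ v := by linarith
  refine lt_of_lt_of_eq (b := 9 / 10 +
      (146098451 * v ^ 9 + 172349356265 * u * v ^ 8 + 4864843707947 * u ^ 2 * v ^ 7 +
        41938359181479 * u ^ 3 * v ^ 6 + 180218368481446 * u ^ 4 * v ^ 5 +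
        450723011237716 * u ^ 5 * v ^ 4 + 691569170024568 * u ^ 6 * v ^ 3 +
        645927882291776 * u ^ 7 * v ^ 2 + 339119104028288 * u ^ 8 * v + 77139760926464 * u ^ 9) /
        2187000000000) (by positivity) ?_
  rw [hv]
  simp only [barrier, barrierSlope]
  ring

lemma barrier_sub_pos {x : ℝ} (hl : -(121 / 250) ≤ x) (hr : x ≤ 3) :
    0 < barrier x - 2111 / 1000 * x ^ 2 := by
  obtain ⟨u, rfl⟩ : ∃ u, x = -121 / 250 + u := ⟨x - (-121 / 250), by ring⟩
  obtain ⟨v, hv⟩ : ∃ v, v = 871 / 250 - u := ⟨_, rfl⟩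
  have hu : 0 ≤ u := by linarith
  have hv0 : 0 ≤ v := by linarith
  refine lt_of_lt_of_eq (b := 7 / 1000 +
      (177809 * v ^ 3 + 1874804425 * u * v ^ 2 + 259968750 * u ^ 2 * v + 2350000000 * u ^ 3) /
        10165789400) (by positivity) ?_
  rw [hv]
  simp only [barrier]
  ring

lemma cube_add_barrierSlope_neg {x : ℝ} (hl : -(57 / 20) ≤ x) (hr : x ≤ -(119 / 250)) :
    0 < -(x ^ 3 + barrierSlope x) := by
  obtain ⟨u, rfl⟩ : ∃ u, x = -57 / 20 + u := ⟨x - (-57 / 20), by ring⟩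
  obtain ⟨v, hv⟩ : ∃ v, v = 1187 / 500 - u := ⟨_, rfl⟩
  have hu : 0 ≤ u := by linarith
  have hv0 : 0 ≤ v := by linarith
  refine lt_of_lt_of_eq (b := 3 / 1000 +
      (5484871875 * v ^ 3 + 3092259875 * u * v ^ 2 + 952342210 * u ^ 2 * v + 61804 * u ^ 3) /
        3344892406) (by positivity) ?_
  rw [hv]
  simp only [barrierSlope]
  ring

/-- At a point of the curve `y ^ 2 = barrier x`, the reversed flow enters `y ^ 2 < barrier x`. -/
lemma barrier_transversal {d x y : ℝ} (hd : d ≤ 2111 / 1000) (hl : -(57 / 20) ≤ x) (hr : x ≤ 3)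
    (hy : 0 < y) (hxy : y ^ 2 = barrier x) :
    0 < y ^ 3 - d * x ^ 2 * y - x ^ 3 - barrierSlope x := by
  have hmono : 0 ≤ (2111 / 1000 - d) * (x ^ 2 * y) :=
    mul_nonneg (by linarith) (by positivity)
  suffices h : x ^ 3 + barrierSlope x < y * (barrier x - 2111 / 1000 * x ^ 2) by
    have : y ^ 3 = y * barrier x := by rw [← hxy]; ring
    linarith
  have hsq : (y * (barrier x - 2111 / 1000 * x ^ 2)) ^ 2 =
      barrier x * (barrier x - 2111 / 1000 * x ^ 2) ^ 2 := by rw [← hxy]; ring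
  rcases le_or_gt x (-(121 / 250)) with h₁ | h₁
  · have hR := cube_add_barrierSlope_neg hl (by linarith)
    have hT : (y * (barrier x - 2111 / 1000 * x ^ 2)) ^ 2 < (-(x ^ 3 + barrierSlope x)) ^ 2 := by
      rw [hsq, neg_sq]
      rcases le_total x (-(3 / 2)) with h | h
      · linarith [barrier_sq_gap_pos_left hl h]
      · linarith [barrier_sq_gap_pos_midleft h h₁]
    linarith [(abs_lt_of_sq_lt_sq' hT hR.le).1]
  · have hS := barrier_sub_pos h₁.le hr
    have hyS := mul_pos hy hS
    rcases le_or_gt x (-(119 / 250)) with h₂ | h₂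
    · linarith [cube_add_barrierSlope_neg hl h₂]
    · refine lt_of_pow_lt_pow_left₀ 2 hyS.le ?_
      rw [hsq]
      rcases le_total x (3 / 2) with h | h
      · linarith [barrier_sq_gap_pos_midright h₂.le h]
      · linarith [barrier_sq_gap_pos_right h hr]

section ReversedSystem

/-- The vector field of `ẋ = y, ẏ = -x³ - d x² y + y³` with time reversed. -/
def reversedField (d : ℝ) (p : ℝ × ℝ) : ℝ × ℝ :=
  (-p.2, p.1 ^ 3 + d * p.1 ^ 2 * p.2 - p.2 ^ 3)

/-- Retraction of the plane onto the closed ball of radius `6` for the sup norm. -/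
noncomputable def clampBox (p : ℝ × ℝ) : ℝ × ℝ := (max (-6) (min 6 p.1), max (-6) (min 6 p.2))

lemma norm_clampBox_le (p : ℝ × ℝ) : ‖clampBox p‖ ≤ 6 := by
  simp [clampBox, Prod.norm_def, abs_le]

lemma clampBox_of_norm_le {p : ℝ × ℝ} (hp : ‖p‖ ≤ 6) : clampBox p = p := by
  simp only [Prod.norm_def, Real.norm_eq_abs, max_le_iff, abs_le] at hp
  simp [clampBox, hp]

lemma clampBox_neg (p : ℝ × ℝ) : clampBox (-p) = -clampBox p := by
  ext <;> simp only [clampBox, Prod.fst_neg, Prod.snd_neg] <;> grind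

lemma reversedField_neg (d : ℝ) (p : ℝ × ℝ) : reversedField d (-p) = -reversedField d p := by
  ext <;> simp only [reversedField, Prod.fst_neg, Prod.snd_neg]
  ring

lemma lipschitzWith_clampBox : LipschitzWith 1 clampBox := by
  have h := ((LipschitzWith.prod_fst (α := ℝ) (β := ℝ)).const_min 6).const_max (-6)
  have h' := ((LipschitzWith.prod_snd (α := ℝ) (β := ℝ)).const_min 6).const_max (-6)
  exact (max_self (1 : ℝ≥0)) ▸ h.prodMk h'

lemma exists_lipschitzWith_reversedField_clampBox (d : ℝ) :
    ∃ K : ℝ≥0, LipschitzWith K fun p ↦ reversedField d (clampBox p) := by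
  have hsmooth : ContDiff ℝ 1 (reversedField d) := by unfold reversedField; fun_prop
  obtain ⟨K, hK⟩ := (hsmooth.locallyLipschitz.locallyLipschitzOn
    (s := closedBall 0 6)).exists_lipschitzOnWith_of_compact (isCompact_closedBall _ _)
  refine ⟨K * 1, lipschitzOnWith_univ.1 (hK.comp lipschitzWith_clampBox.lipschitzOnWith ?_)⟩
  exact fun p _ ↦ by simpa using norm_clampBox_le p

lemma exists_norm_reversedField_clampBox_le (d : ℝ) :
    ∃ L : ℝ≥0, ∀ p, ‖reversedField d (clampBox p)‖ ≤ L := by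
  have hcont : Continuous (reversedField d) := by unfold reversedField; fun_prop
  obtain ⟨C, hC⟩ := (isCompact_closedBall (0 : ℝ × ℝ) 6).exists_bound_of_continuousOn
    hcont.continuousOn
  exact ⟨C.toNNReal, fun p ↦ (hC _ (by simpa using norm_clampBox_le p)).trans
    (Real.le_coe_toNNReal C)⟩

lemma antitoneOn_of_forall_hasDerivAt {f f' : ℝ → ℝ} {D : Set ℝ} (hD : Convex ℝ D)
    (hf : ∀ t ∈ D, HasDerivAt f (f' t) t) (hf' : ∀ t ∈ interior D, f' t ≤ 0) :
    AntitoneOn f D :=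
  antitoneOn_of_hasDerivWithinAt_nonpos hD (HasDerivAt.continuousOn hf)
    (fun t ht ↦ (hf t (interior_subset ht)).hasDerivWithinAt) hf'

variable {d s : ℝ} {α : ℝ → ℝ × ℝ}

lemma hasDerivAt_fst_of_reversedField {p : ℝ × ℝ} {t : ℝ}
    (h : HasDerivAt α (reversedField d p) t) : HasDerivAt (fun t ↦ (α t).1) (-p.2) t :=
  h.fst

lemma hasDerivAt_snd_of_reversedField {p : ℝ × ℝ} {t : ℝ}
    (h : HasDerivAt α (reversedField d p) t) :
    HasDerivAt (fun t ↦ (α t).2) (p.1 ^ 3 + d * p.1 ^ 2 * p.2 - p.2 ^ 3) t :=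
  h.snd

lemma hasDerivAt_barrier (x : ℝ) : HasDerivAt barrier (2 * barrierSlope x) x := by
  have h : HasDerivAt (fun x : ℝ ↦ (x + 57 / 20) * (39 * x ^ 2 + 37 * x + 30) / 100)
      ((1 * (39 * x ^ 2 + 37 * x + 30) +
        (x + 57 / 20) * (39 * (2 * x ^ 1 * 1) + 37 * 1)) / 100) x := by
    have hid := hasDerivAt_id x
    exact (((hid.add_const _).mul ((((hid.pow 2).const_mul 39).add
      (hid.const_mul 37)).add_const 30)).div_const 100)
  refine HasDerivAt.congr_deriv h ?_
  unfold barrierSlope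
  ring

lemma neg_lt_of_barrier_pos {x : ℝ} (h : 0 < barrier x) : -(57 / 20) < x := by
  by_contra! hx
  refine h.not_ge (div_nonpos_of_nonpos_of_nonneg (mul_nonpos_of_nonpos_of_nonneg ?_ ?_) ?_) <;>
    nlinarith [sq_nonneg (x + 1 / 2)]

lemma neg_le_of_barrier_nonneg {x : ℝ} (h : 0 ≤ barrier x) : -(57 / 20) ≤ x := by
  by_contra! hx
  refine h.not_gt (div_neg_of_neg_of_pos (mul_neg_of_neg_of_pos ?_ ?_) ?_) <;>
    nlinarith [sq_nonneg (x + 1 / 2)]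

lemma barrier_lt {x : ℝ} (hl : -(57 / 20) ≤ x) (hr : x ≤ 3) : barrier x < 36 := by
  have h : (x + 57 / 20) * (39 * x ^ 2 + 37 * x + 30) ≤ (117 / 20) * 492 :=
    mul_le_mul (by linarith) (by nlinarith) (by nlinarith [sq_nonneg (x + 1 / 2)]) (by norm_num)
  unfold barrier
  linarith

lemma norm_le_six_of_sq_le_barrier {p : ℝ × ℝ} (hp : p.2 ^ 2 ≤ barrier p.1) (hr : p.1 ≤ 3) :
    ‖p‖ ≤ 6 := by
  have hl := neg_le_of_barrier_nonneg ((sq_nonneg _).trans hp)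
  have h36 := barrier_lt hl hr
  simp only [Prod.norm_def, Real.norm_eq_abs, max_le_iff]
  exact ⟨abs_le.2 ⟨by linarith, by linarith⟩, abs_le_of_sq_le_sq (by linarith) (by norm_num)⟩

/-- As long as an orbit starting on the positive `x`-axis stays in the domain
`0 < y + max x 0`, it stays in the region bounded by the `x`-axis and the barrier. -/
lemma mem_region_of_forall_pos (hd : d ≤ 2111 / 1000) (hs : s ∈ Ioc 0 3) (h0 : α 0 = (s, 0))
    (hα : ∀ t, HasDerivAt α (reversedField d (clampBox (α t))) t) {T : ℝ}
    (hG : ∀ t ∈ Ico 0 T, 0 < (α t).2 + max (α t).1 0) :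
    (∀ t ∈ Ioo 0 T, 0 < (α t).2) ∧ AntitoneOn (fun t ↦ (α t).1) (Ico 0 T) ∧
      ∀ t ∈ Ico 0 T, ‖α t‖ ≤ 6 ∧ -(57 / 20) < (α t).1 := by
  have hx t := hasDerivAt_fst_of_reversedField (hα t)
  have hy t := hasDerivAt_snd_of_reversedField (hα t)
  have hypos : ∀ t ∈ Ioo 0 T, 0 < (α t).2 := by
    refine pos_of_deriv_pos_at_zeros hy (by simp [h0]) fun t ht hyt ↦ ?_
    have hGt := hG t ht
    rw [hyt, zero_add, lt_max_iff, or_iff_left (lt_irrefl _)] at hGt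
    have : 0 < (clampBox (α t)).1 := by simp [clampBox, hGt]
    have h2 : (clampBox (α t)).2 = 0 := by simp [clampBox, hyt]
    rw [h2]
    simpa using pow_pos this 3
  have hanti : AntitoneOn (fun t ↦ (α t).1) (Ico 0 T) := by
    refine antitoneOn_of_forall_hasDerivAt (convex_Ico 0 T) (fun t _ ↦ hx t) fun t ht ↦ ?_
    rw [interior_Ico] at ht
    simp [clampBox, (hypos t ht).le]
  have hle : ∀ t ∈ Ico 0 T, (α t).1 ≤ 3 := fun t ht ↦ by
    have h := hanti ⟨le_rfl, ht.1.trans_lt ht.2⟩ ht ht.1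
    simp only [h0] at h
    exact h.trans hs.2
  have hs0 : 0 < barrier s := by
    have := hs.1
    unfold barrier
    positivity
  have hB : ∀ t ∈ Ioo 0 T, 0 < barrier (α t).1 - (α t).2 ^ 2 := by
    have hderiv t : HasDerivAt (fun t ↦ barrier (α t).1 - (α t).2 ^ 2) _ t :=
      ((hasDerivAt_barrier _).comp t (hx t)).sub ((hy t).pow 2)
    refine pos_of_deriv_pos_at_zeros hderiv (by simp [h0, hs0.le]) fun t ht hBt ↦ ?_
    have hyt : 0 < (α t).2 := by
      rcases ht.1.eq_or_lt with rfl | h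
      · simp [h0, hs0.ne'] at hBt
      · exact hypos t ⟨h, ht.2⟩
    have hsq : (α t).2 ^ 2 = barrier (α t).1 := by linarith
    rw [clampBox_of_norm_le (norm_le_six_of_sq_le_barrier hsq.le (hle t ht))]
    have := mul_pos hyt (barrier_transversal hd
      (neg_le_of_barrier_nonneg (hsq ▸ sq_nonneg _)) (hle t ht) hyt hsq)
    norm_num
    linarith
  have hB' : ∀ t ∈ Ico 0 T, 0 < barrier (α t).1 - (α t).2 ^ 2 := fun t ht ↦ by
    rcases ht.1.eq_or_lt with rfl | h
    · simp [h0, hs0]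
    · exact hB t ⟨h, ht.2⟩
  refine ⟨hypos, hanti, fun t ht ↦ ?_⟩
  have := hB' t ht
  exact ⟨norm_le_six_of_sq_le_barrier (by linarith) (hle t ht),
    neg_lt_of_barrier_pos (by linarith [sq_nonneg (α t).2])⟩

/-- An orbit starting on the positive `x`-axis reaches the negative `x`-axis. -/
lemma exists_nonpos (hd0 : 0 < d) (hd : d ≤ 2111 / 1000) (hs : s ∈ Ioc 0 3) (h0 : α 0 = (s, 0))
    (hα : ∀ t, HasDerivAt α (reversedField d (clampBox (α t))) t) :
    ∃ t, 0 ≤ t ∧ (α t).2 + max (α t).1 0 ≤ 0 := by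
  by_contra! hG
  have hreg T := mem_region_of_forall_pos (T := T) hd hs h0 hα fun t ht ↦ hG t ht.1
  have hypos : ∀ t, 0 < t → 0 < (α t).2 := fun t ht ↦ (hreg (t + 1)).1 t ⟨ht, by linarith⟩
  have hxl : ∀ t, 0 ≤ t → -(57 / 20) < (α t).1 :=
    fun t ht ↦ ((hreg (t + 1)).2.2 t ⟨ht, by linarith⟩).2
  have hxanti : ∀ t t', 0 ≤ t → t ≤ t' → (α t').1 ≤ (α t).1 := fun t t' ht htt' ↦
    (hreg (t' + 1)).2.1 ⟨ht, by linarith⟩ ⟨ht.trans htt', by linarith⟩ htt'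
  have hα' t (ht : 0 ≤ t) : HasDerivAt α (reversedField d (α t)) t := by
    simpa only [clampBox_of_norm_le ((hreg (t + 1)).2.2 t ⟨ht, by linarith⟩).1] using hα t
  have hx t ht := hasDerivAt_fst_of_reversedField (hα' t ht)
  have hy t ht := hasDerivAt_snd_of_reversedField (hα' t ht)
  obtain ⟨t₀, ht₀, hxt₀⟩ : ∃ t₀, 0 ≤ t₀ ∧ (α t₀).1 < 0 := by
    by_contra! hxpos
    have hanti : AntitoneOn (fun t ↦ ((α t).2)⁻¹ + (α t).1) (Ici 1) := by
      refine antitoneOn_of_forall_hasDerivAt (convex_Ici 1)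
        (fun t (ht : 1 ≤ t) ↦ ((hy t (by linarith)).inv (hypos t (by linarith)).ne').add
          (hx t (by linarith))) fun t ht ↦ ?_
      rw [interior_Ici, mem_Ioi] at ht
      have hyt := hypos t (by linarith)
      have hxt := hxpos t (by linarith)
      have : -((α t).1 ^ 3 + d * (α t).1 ^ 2 * (α t).2 - (α t).2 ^ 3) / (α t).2 ^ 2 ≤
          (α t).2 := by
        rw [div_le_iff₀ (by positivity)]
        have : 0 ≤ (α t).1 ^ 3 + d * (α t).1 ^ 2 * (α t).2 := by positivity
        linarith
      linarith
    set K := ((α 1).2)⁻¹ + (α 1).1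
    have hK : 0 < K := add_pos_of_pos_of_nonneg (inv_pos.2 (hypos 1 one_pos))
      (hxpos 1 zero_le_one)
    have hylow : ∀ t, 1 ≤ t → K⁻¹ ≤ (α t).2 := fun t ht ↦ by
      have h : ((α t).2)⁻¹ + (α t).1 ≤ K := hanti self_mem_Ici ht ht
      exact inv_le_of_inv_le₀ (hypos t (by linarith)) (by linarith [hxpos t (by linarith)])
    have hanti' : AntitoneOn (fun t ↦ (α t).1 + K⁻¹ * t) (Ici 1) := by
      refine antitoneOn_of_forall_hasDerivAt (convex_Ici 1)
        (fun t (ht : 1 ≤ t) ↦ (hx t (by linarith)).add ((hasDerivAt_id t).const_mul K⁻¹))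
        fun t ht ↦ ?_
      rw [interior_Ici, mem_Ioi] at ht
      linarith [hylow t ht.le]
    have hx1 := hxpos 1 zero_le_one
    have hle : (1 : ℝ) ≤ 1 + K * ((α 1).1 + 1) := by
      have : 0 ≤ K * ((α 1).1 + 1) := by positivity
      linarith
    have h := hanti' self_mem_Ici hle hle
    have hcancel : K⁻¹ * (1 + K * ((α 1).1 + 1)) = K⁻¹ + ((α 1).1 + 1) := by field_simp
    simp only [hcancel] at h
    linarith [hxpos _ (zero_le_one.trans hle)]
  set c := -(α t₀).1
  have hc : 0 < c := neg_pos.2 hxt₀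
  have hanti : AntitoneOn (fun t ↦ (α t).2 + c ^ 3 * t + d / 3 * (α t).1 ^ 3) (Ici t₀) := by
    refine antitoneOn_of_forall_hasDerivAt (convex_Ici t₀)
      (fun t (ht : t₀ ≤ t) ↦ ((hy t (ht₀.trans ht)).add
        ((hasDerivAt_id t).const_mul (c ^ 3))).add
        (((hx t (ht₀.trans ht)).pow 3).const_mul (d / 3))) fun t ht ↦ ?_
    rw [interior_Ici, mem_Ioi] at ht
    have hyt := pow_pos (hypos t (ht₀.trans_lt ht)) 3
    have hcx : c ^ 3 ≤ (-(α t).1) ^ 3 :=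
      pow_le_pow_left₀ hc.le (neg_le_neg (hxanti t₀ t ht₀ ht.le)) 3
    norm_num
    linarith
  set C := (α t₀).2 + c ^ 3 * t₀ + d / 3 * (α t₀).1 ^ 3
  have hmem : t₀ ≤ max (t₀ + 1) ((C + 8 * d) / c ^ 3) :=
    (by linarith : t₀ ≤ t₀ + 1).trans (le_max_left _ _)
  have h := hanti self_mem_Ici hmem hmem
  set t := max (t₀ + 1) ((C + 8 * d) / c ^ 3)
  have ht : C + 8 * d ≤ c ^ 3 * t := by
    rw [← div_le_iff₀' (by positivity)]
    exact le_max_right _ _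
  have hxc : (-(57 / 20)) ^ 3 ≤ (α t).1 ^ 3 :=
    (Odd.pow_le_pow (by decide)).2 (hxl t (ht₀.trans hmem)).le
  have := mul_le_mul_of_nonneg_left hxc hd0.le
  have hyt := hypos t (by linarith [le_max_left (t₀ + 1) ((C + 8 * d) / c ^ 3)])
  have h' : (α t).2 + c ^ 3 * t + d / 3 * (α t).1 ^ 3 ≤ C := h
  linarith

/-- `τ` is the first positive time at which the orbit `α`, starting on the positive `x`-axis, meets
the negative `x`-axis, and this orbit crosses the upper half-plane inside the box of radius `6`. -/
structure IsFirstReturn (α : ℝ → ℝ × ℝ) (τ : ℝ) : Prop where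
  pos : 0 < τ
  snd_eq_zero : (α τ).2 = 0
  fst_neg : (α τ).1 < 0
  neg_le_fst : -(57 / 20) ≤ (α τ).1
  antitoneOn : AntitoneOn (fun t ↦ (α t).1) (Icc 0 τ)
  norm_le : ∀ t ∈ Icc 0 τ, ‖α t‖ ≤ 6
  snd_pos : ∀ t ∈ Ioo 0 τ, 0 < (α t).2
  forall_pos : ∀ t ∈ Ico 0 τ, 0 < (α t).2 + max (α t).1 0
  eventually_neg : ∀ᶠ t in 𝓝[>] τ, (α t).2 + max (α t).1 0 < 0

lemma exists_isFirstReturn (hd0 : 0 < d) (hd : d ≤ 2111 / 1000) (hs : s ∈ Ioc 0 3)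
    (h0 : α 0 = (s, 0)) (hα : ∀ t, HasDerivAt α (reversedField d (clampBox (α t))) t) :
    ∃ τ, IsFirstReturn α τ := by
  have hx t := hasDerivAt_fst_of_reversedField (hα t)
  have hy t := hasDerivAt_snd_of_reversedField (hα t)
  have hcont : Continuous α := continuous_iff_continuousAt.2 fun t ↦ (hα t).continuousAt
  obtain ⟨b, hb, hGb⟩ := exists_nonpos hd0 hd hs h0 hα
  obtain ⟨τ, ⟨hτ, -⟩, hGτ, hpos⟩ := exists_first_zero (f := fun t ↦ (α t).2 + max (α t).1 0)
    (by fun_prop) hb (by simp [h0, hs.1]) hGb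
  obtain ⟨hypos, -, hbox⟩ := mem_region_of_forall_pos hd hs h0 hα hpos
  have hclosure {C : Set (ℝ × ℝ)} (hC : IsClosed C) (h : ∀ t ∈ Ioo 0 τ, α t ∈ C) :
      ∀ t ∈ Icc 0 τ, α t ∈ C := by
    rw [← closure_Ioo hτ.ne]
    exact closure_minimal h (hC.preimage hcont)
  have hτmem : τ ∈ Icc 0 τ := ⟨hτ.le, le_rfl⟩
  have hynonneg : ∀ t ∈ Icc 0 τ, 0 ≤ (α t).2 :=
    hclosure (C := {p | 0 ≤ p.2}) (isClosed_le continuous_const continuous_snd)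
      fun t ht ↦ (hypos t ht).le
  have hnorm : ∀ t ∈ Icc 0 τ, ‖α t‖ ≤ 6 :=
    hclosure (C := {p | ‖p‖ ≤ 6}) (isClosed_le continuous_norm continuous_const)
      fun t ht ↦ (hbox t ⟨ht.1.le, ht.2⟩).1
  have hlow : ∀ t ∈ Icc 0 τ, -(57 / 20) ≤ (α t).1 :=
    hclosure (C := {p | -(57 / 20) ≤ p.1}) (isClosed_le continuous_const continuous_fst)
      fun t ht ↦ (hbox t ⟨ht.1.le, ht.2⟩).2.le
  have hyτ : (α τ).2 = 0 := by
    linarith [hynonneg τ hτmem, le_max_right (α τ).1 0]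
  have hxτ : (α τ).1 < 0 := by
    refine lt_of_le_of_ne (by linarith [le_max_left (α τ).1 0]) fun hxτ ↦ hs.1.ne' ?_
    obtain ⟨K, hK⟩ := exists_lipschitzWith_reversedField_clampBox d
    have h : α = fun _ ↦ 0 := hK.integralCurve_unique hα (t₀ := τ)
      (fun t ↦ (hasDerivAt_const t _).congr_deriv (by ext <;> simp [clampBox, reversedField]))
      (Prod.ext hxτ hyτ)
    simpa [h0] using congrArg Prod.fst (congrFun h 0)
  refine ⟨τ, hτ, hyτ, hxτ, hlow τ hτmem, ?_, hnorm, hypos, hpos, ?_⟩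
  · refine antitoneOn_of_forall_hasDerivAt (convex_Icc 0 τ) (fun t _ ↦ hx t) fun t ht ↦ ?_
    rw [interior_Icc] at ht
    simp [clampBox, (hypos t ht).le]
  · have hy' : HasDerivAt (fun t ↦ -(α t).2) (-(α τ).1 ^ 3) τ := by
      have h := (hy τ).neg
      rw [clampBox_of_norm_le (hnorm τ hτmem), hyτ] at h
      exact h.congr_deriv (by ring)
    have hxneg : ∀ᶠ t in 𝓝[>] τ, (α t).1 < 0 :=
      nhdsWithin_le_nhds ((hx τ).continuousAt.eventually (gt_mem_nhds hxτ))
    filter_upwards [hxneg, hy'.eventually_pos_right (by simp [hyτ])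
      (by linarith [Odd.pow_neg (by decide : Odd 3) hxτ])] with t h₁ h₂
    rw [max_eq_right h₁.le]
    linarith

/-- Orbits close to the origin spiral away from it. -/
lemma IsFirstReturn.fst_lt_neg (hd0 : 0 < d) (hd : d ≤ 2111 / 1000) (h0 : α 0 = (d / 60, 0))
    (hα : ∀ t, HasDerivAt α (reversedField d (clampBox (α t))) t) {τ : ℝ}
    (h : IsFirstReturn α τ) : (α τ).1 < -(d / 60) := by
  by_contra! hle
  obtain ⟨s, rfl⟩ : ∃ s, d = 60 * s := ⟨d / 60, by ring⟩
  rw [mul_div_cancel_left₀ s (by norm_num)] at h0 hle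
  have hs : 0 < s := by linarith
  have hs' : s ≤ 9 / 250 := by linarith
  have hα' : ∀ t ∈ Icc 0 τ, HasDerivAt α (reversedField (60 * s) (α t)) t := fun t ht ↦ by
    simpa only [clampBox_of_norm_le (h.norm_le t ht)] using hα t
  have hxs : ∀ t ∈ Icc 0 τ, |(α t).1| ≤ s := fun t ht ↦ by
    have h₁ := h.antitoneOn ht ⟨h.pos.le, le_rfl⟩ ht.2
    have h₂ := h.antitoneOn ⟨le_rfl, h.pos.le⟩ ht ht.1
    simp only [h0] at h₁ h₂
    exact abs_le.2 ⟨hle.trans h₁, h₂⟩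
  have hys : ∀ t ∈ Ioo 0 τ, 0 < 3 * s - (α t).2 := by
    refine pos_of_deriv_pos_at_zeros
      (fun t ↦ (hasDerivAt_snd_of_reversedField (hα t)).const_sub (3 * s))
      (by simp [h0, hs.le]) fun t ht hyt ↦ ?_
    rw [clampBox_of_norm_le (h.norm_le t ⟨ht.1, ht.2.le⟩)]
    have hyt' : (α t).2 = 3 * s := by linarith
    have hx := hxs t ⟨ht.1, ht.2.le⟩
    have hx2 : (α t).1 ^ 2 ≤ s ^ 2 := sq_le_sq' (abs_le.1 hx).1 (abs_le.1 hx).2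
    have hx3 : (α t).1 ^ 3 ≤ s ^ 3 := (Odd.pow_le_pow (by decide)).2 (abs_le.1 hx).2
    have h1 : 180 * s ^ 2 * (α t).1 ^ 2 ≤ 180 * s ^ 2 * s ^ 2 := by gcongr
    have h2 : s * s ^ 3 ≤ 9 / 250 * s ^ 3 := by gcongr
    have h3 := pow_pos hs 3
    rw [hyt']
    linarith
  have hV : StrictMonoOn
      (fun t ↦ (α t).1 ^ 4 / 4 + (α t).2 ^ 2 / 2 - 2 * ((α t).1 * (α t).2 ^ 3)) (Icc 0 τ) := by
    have hderiv t (ht : t ∈ Icc 0 τ) := (((hasDerivAt_fst_of_reversedField (hα' t ht)).pow 4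
      |>.div_const 4).add ((hasDerivAt_snd_of_reversedField (hα' t ht)).pow 2
      |>.div_const 2)).sub (((hasDerivAt_fst_of_reversedField (hα' t ht)).mul
      ((hasDerivAt_snd_of_reversedField (hα' t ht)).pow 3)).const_mul 2)
    refine strictMonoOn_of_hasDerivWithinAt_pos (convex_Icc 0 τ) (HasDerivAt.continuousOn hderiv)
      (fun t ht ↦ (hderiv t (interior_subset ht)).hasDerivWithinAt) fun t ht ↦ ?_
    rw [interior_Icc] at ht
    have hy := h.snd_pos t ht
    have hy' := hys t ht
    have hx := hxs t ⟨ht.1.le, ht.2.le⟩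
    simp only [Pi.pow_apply]
    generalize (α t).1 = x at *
    generalize (α t).2 = y at *
    suffices 0 < y ^ 2 * (60 * s * x ^ 2 + y ^ 2 - 6 * x ^ 4 - 360 * s * x ^ 3 * y +
        6 * x * y ^ 3) by
      norm_num
      linarith
    have hx2 : x ^ 2 ≤ s ^ 2 := sq_le_sq' (abs_le.1 hx).1 (abs_le.1 hx).2
    have hss : s ^ 2 ≤ 9 / 250 * s := by rw [sq]; gcongr
    have hxy : |x * y| ≤ 3 * s ^ 2 := by
      rw [abs_mul, abs_of_pos hy]
      calc |x| * y ≤ s * (3 * s) := by gcongr; linarith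
        _ = 3 * s ^ 2 := by ring
    have h1 : x ^ 2 * x ^ 2 ≤ s ^ 2 * x ^ 2 := by gcongr
    have h2 : s * x ^ 2 * (x * y) ≤ s * x ^ 2 * (3 * s ^ 2) :=
      mul_le_mul_of_nonneg_left (abs_le.1 hxy).2 (by positivity)
    have h3 : y ^ 2 * (-(3 * s ^ 2)) ≤ y ^ 2 * (x * y) :=
      mul_le_mul_of_nonneg_left (abs_le.1 hxy).1 (by positivity)
    have h4 : s ^ 2 * x ^ 2 ≤ 9 / 250 * s * x ^ 2 := by gcongr
    have h5 : s ^ 2 * y ^ 2 ≤ 1 / 500 * y ^ 2 := by gcongr; linarith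
    have h6 : s ^ 2 * (s * x ^ 2) ≤ 1 / 500 * (s * x ^ 2) := by gcongr; linarith
    have h7 : 0 ≤ s * x ^ 2 := by positivity
    have h8 : 0 < y ^ 2 := by positivity
    refine mul_pos h8 ?_
    linarith
  have hlt := hV ⟨le_rfl, h.pos.le⟩ ⟨h.pos.le, le_rfl⟩ h.pos
  simp only [h0, h.snd_eq_zero] at hlt
  have := pow_le_pow_left₀ (abs_nonneg _) (hxs τ ⟨h.pos.le, le_rfl⟩) 4
  rw [Even.pow_abs (by decide)] at this
  linarith

/-- Some orbit of the truncated system crosses the upper half-plane between two opposite points. -/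
lemma exists_antipodal_return (hd0 : 0 < d) (hd : d ≤ 2111 / 1000) :
    ∃ (α : ℝ → ℝ × ℝ) (τ : ℝ), (∀ t, HasDerivAt α (reversedField d (clampBox (α t))) t) ∧
      IsFirstReturn α τ ∧ α τ = -α 0 := by
  obtain ⟨K, hK⟩ := exists_lipschitzWith_reversedField_clampBox d
  obtain ⟨L, hL⟩ := exists_norm_reversedField_clampBox_le d
  choose Φ hΦ0 hΦ using fun s : ℝ ↦ hK.exists_hasDerivAt_of_bounded hL (s, 0)
  have hΦcont : Continuous fun p : ℝ × ℝ ↦ Φ p.1 p.2 :=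
    hK.continuous_flow hΦ (by simp only [hΦ0]; fun_prop)
  have hpos : ∀ s ∈ Icc (d / 60) 3, s ∈ Ioc (0 : ℝ) 3 := fun s hs ↦
    ⟨(by positivity : 0 < d / 60).trans_le hs.1, hs.2⟩
  choose! τ hτ using fun s (hs : s ∈ Icc (d / 60) 3) ↦
    exists_isFirstReturn hd0 hd (hpos s hs) (hΦ0 s) (hΦ s)
  have hτcont : ContinuousOn τ (Icc (d / 60) 3) :=
    continuousOn_hittingTime (G := fun s t ↦ (Φ s t).2 + max (Φ s t).1 0) (by fun_prop)
      (fun s hs ↦ (hτ s hs).pos)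
      (fun s hs ↦ by simp [(hτ s hs).snd_eq_zero, (hτ s hs).fst_neg.le])
      (fun s hs ↦ (hτ s hs).forall_pos) fun s hs ↦ (hτ s hs).eventually_neg
  have hle : d / 60 ≤ 3 := by linarith
  have hψ : ContinuousOn (fun s ↦ (Φ s (τ s)).1 + s) (Icc (d / 60) 3) :=
    (hΦcont.comp_continuousOn (continuousOn_id.prodMk hτcont)).fst.add continuousOn_id
  have hleft := (hτ _ (left_mem_Icc.2 hle)).fst_lt_neg hd0 hd (hΦ0 _) (hΦ _)
  have hright := (hτ _ (right_mem_Icc.2 hle)).neg_le_fst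
  obtain ⟨s, hs, hs0⟩ := intermediate_value_Icc hle hψ
    (show (0 : ℝ) ∈ Icc _ _ from ⟨by linarith, by linarith⟩)
  refine ⟨Φ s, τ s, hΦ s, hτ s hs, Prod.ext ?_ ?_⟩
  · simpa [hΦ0] using eq_neg_of_add_eq_zero_left hs0
  · simp [hΦ0, (hτ s hs).snd_eq_zero]

/-- The reversed system has a nonconstant periodic orbit. -/
lemma exists_periodic_reversedField (hd0 : 0 < d) (hd : d ≤ 2111 / 1000) :
    ∃ (α : ℝ → ℝ × ℝ) (τ : ℝ), 0 < τ ∧ (∀ t, HasDerivAt α (reversedField d (α t)) t) ∧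
      Function.Antiperiodic α τ ∧ α 0 ≠ 0 := by
  obtain ⟨α, τ, hα, hτ, hanti⟩ := exists_antipodal_return hd0 hd
  obtain ⟨K, hK⟩ := exists_lipschitzWith_reversedField_clampBox d
  have hneg t : HasDerivAt (-α) (reversedField d (clampBox ((-α) t))) t := by
    rw [Pi.neg_apply, clampBox_neg, reversedField_neg]
    exact (hα t).neg
  have hperiod : Function.Antiperiodic α τ := fun t ↦ congrFun
    (hK.integralCurve_unique (fun t ↦ (hα (t + τ)).comp_add_const t τ) hneg (t₀ := 0)
      (by simpa using hanti)) t
  have hnorm t : ‖α t‖ ≤ 6 := by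
    have hp : Function.Periodic (fun t ↦ ‖α t‖) τ := fun t ↦ by simp [hperiod t]
    obtain ⟨r, hr, hr'⟩ := hp.exists_mem_Ico₀ hτ.pos t
    exact hr' ▸ hτ.norm_le r ⟨hr.1, hr.2.le⟩
  refine ⟨α, τ, hτ.pos, fun t ↦ ?_, hperiod, fun h ↦ ?_⟩
  · simpa only [clampBox_of_norm_le (hnorm t)] using hα t
  · simpa [hanti, h] using hτ.fst_neg

end ReversedSystem

lemma three_mul_rpow_div_rpow_le :
    3 * (-9 + 6 * Real.sqrt 3) ^ ((1 : ℝ) / 3) / (4 : ℝ) ^ ((1 : ℝ) / 3) ≤ 2111 / 1000 := by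
  have hlow : (9 : ℝ) / 6 ≤ Real.sqrt 3 := Real.le_sqrt_of_sq_le (by norm_num)
  have hhigh : Real.sqrt 3 ≤ 17321 / 10000 := (Real.sqrt_le_left (by norm_num)).2 (by norm_num)
  have hnum : (-9 + 6 * Real.sqrt 3) ^ ((1 : ℝ) / 3) ≤ 11168 / 10000 := by
    rw [one_div, Real.rpow_inv_le_iff_of_pos (by linarith) (by norm_num) (by norm_num)]
    norm_num
    linarith
  have hden : (15873 : ℝ) / 10000 ≤ (4 : ℝ) ^ ((1 : ℝ) / 3) := by
    rw [one_div, Real.le_rpow_inv_iff_of_pos (by norm_num) (by norm_num) (by norm_num)]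
    norm_num
  rw [div_le_iff₀ (by linarith)]
  linarith

/-- For each `δ ∈ (δᵢ, 0)` with `δᵢ = -3·(-9 + 6√3)^(1/3)/4^(1/3)`, the system
`ẋ = y, ẏ = -x³ + δx²y + y³` has at least one nonconstant periodic solution. -/
theorem exists_periodic_orbit_quasi_homogeneous
    (δ : ℝ)
    (hl : -3 * (-9 + 6 * Real.sqrt 3) ^ ((1 : ℝ) / 3) / (4 : ℝ) ^ ((1 : ℝ) / 3) < δ)
    (hr : δ < 0) :
    ∃ (γ : ℝ → ℝ × ℝ) (T : ℝ), 0 < T ∧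
      (∀ t : ℝ, HasDerivAt γ
        ((γ t).2, -(γ t).1 ^ 3 + δ * (γ t).1 ^ 2 * (γ t).2 + (γ t).2 ^ 3) t) ∧
      (∀ t : ℝ, γ (t + T) = γ t) ∧
      (∃ t₁ t₂ : ℝ, γ t₁ ≠ γ t₂) := by
  have hd : -δ ≤ 2111 / 1000 := by
    have h := three_mul_rpow_div_rpow_le
    rw [neg_mul, neg_div] at hl
    linarith
  obtain ⟨α, τ, hτ, hα, hanti, hne⟩ := exists_periodic_reversedField (neg_pos.2 hr) hd
  refine ⟨fun t ↦ α (-t), 2 * τ, by positivity, fun t ↦ ?_, fun t ↦ ?_, 0, -τ, ?_⟩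
  · refine ((hα (-t)).scomp t (hasDerivAt_neg t)).congr_deriv ?_
    ext <;> simp only [reversedField, Prod.smul_mk, smul_eq_mul] <;> ring
  · simpa [neg_add_rev, add_comm, sub_eq_add_neg] using hanti.periodic_two_mul.neg (-t)
  · have h := hanti 0
    rw [zero_add] at h
    simpa [h, eq_neg_iff_add_eq_zero, ← two_smul ℝ (α 0)] using hne
end

section
/- For each b with 0 < b ≤ 65349/100000, the quintic system ẋ = y, ẏ = −x + (b² − x²)(y + y³) has at least one nonconstant periodic solution: there exist a nonconstant differentiable γ : ℝ → ℝ² and T > 0 with γ'(t) = (γ₂(t), −γ₁(t) + (b² − γ₁(t)²)(γ₂(t) + γ₂(t)³)) and γ(t+T) = γ(t) for all t. -/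
open Set Filter Topology

/-- A bounded globally Lipschitz autonomous vector field has a jointly continuous flow on every
compact time interval. -/
theorem exists_continuousOn_flow {E : Type*} [NormedAddCommGroup E] [NormedSpace ℝ E]
    [CompleteSpace E] {F : E → E} {K L : NNReal} (hK : LipschitzWith K F)
    (hL : ∀ p, ‖F p‖ ≤ L) (p₀ : E) (r : NNReal) {T : ℝ} (hT : 0 ≤ T) :
    ∃ φ : E × ℝ → E,
      (∀ p ∈ Metric.closedBall p₀ r, φ (p, 0) = p ∧
        ∀ t ∈ Icc 0 T, HasDerivWithinAt (fun s ↦ φ (p, s)) (F (φ (p, t))) (Icc 0 T) t) ∧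
      ContinuousOn φ (Metric.closedBall p₀ r ×ˢ Icc 0 T) := by
  have h : IsPicardLindelof (fun _ ↦ F) (⟨0, le_rfl, hT⟩ : Icc (0 : ℝ) T) p₀
      (r + L * T.toNNReal) r L K := by
    refine IsPicardLindelof.of_time_independent (fun p _ ↦ hL p) hK.lipschitzOnWith ?_
    simp [hT]
  exact h.exists_forall_mem_closedBall_eq_hasDerivWithinAt_continuousOn

/-- An arc of an odd vector field joining a point to its antipode extends to a periodic integral
curve. -/
theorem exists_periodic_of_antipodal_arc {E : Type*} [NormedAddCommGroup E] [NormedSpace ℝ E]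
    {F : E → E} (hF : ∀ p, F (-p) = -F p) {T : ℝ} (hT : 0 < T) {φ : ℝ → E}
    (hφ : ∀ t ∈ Icc 0 T, HasDerivWithinAt φ (F (φ t)) (Icc 0 T) t) (hend : φ T = -φ 0) :
    ∃ γ : ℝ → E, (∀ t, HasDerivAt γ (F (γ t)) t) ∧ (∀ t, γ (t + 2 * T) = γ t) ∧
      γ 0 = φ 0 ∧ γ T = φ T := by
  let γ : ℝ → E := fun t ↦ ((-1 : ℝ) ^ ⌊t / T⌋) • φ (t - ⌊t / T⌋ * T)
  have hfl : ∀ (n : ℤ) (t : ℝ), n * T ≤ t → t < (n + 1) * T → ⌊t / T⌋ = n := by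
    intro n t h1 h2
    rw [Int.floor_eq_iff, le_div_iff₀ hT, div_lt_iff₀ hT]
    exact ⟨h1, h2⟩
  have key : ∀ n : ℤ, ∀ t ∈ Icc (n * T) ((n + 1) * T),
      γ t = ((-1 : ℝ) ^ n) • φ (t - n * T) := by
    intro n t ht
    rcases ht.2.lt_or_eq with h | h
    · simp only [γ, hfl n t ht.1 h]
    · have h1 : ⌊t / T⌋ = n + 1 :=
        hfl (n + 1) t (by push_cast; exact h.ge) (by push_cast; nlinarith)
      have h2 : t - ((n + 1 : ℤ) : ℝ) * T = 0 := by push_cast; linarith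
      have h3 : t - n * T = T := by linarith
      simp only [γ, h1]
      rw [h2, h3, hend, zpow_add_one₀ (by norm_num)]
      simp
  have hodd : ∀ (n : ℤ) (p : E), F (((-1 : ℝ) ^ n) • p) = ((-1 : ℝ) ^ n) • F p := by
    intro n p
    rcases Int.even_or_odd n with h | h
    · simp [h.neg_one_zpow]
    · simp [h.neg_one_zpow, hF]
  have hder : ∀ n : ℤ, ∀ t ∈ Icc (n * T) ((n + 1) * T),
      HasDerivWithinAt γ (F (γ t)) (Icc (n * T) ((n + 1) * T)) t := by
    intro n t ht
    have hmaps : MapsTo (fun s ↦ s - n * T) (Icc (n * T) ((n + 1) * T)) (Icc 0 T) := by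
      intro s hs
      exact ⟨by linarith [hs.1], by linarith [hs.2]⟩
    have h1 := (hφ _ (hmaps ht)).scomp t ((hasDerivWithinAt_id t _).sub_const (n * T)) hmaps
    have h2 := h1.const_smul ((-1 : ℝ) ^ n)
    rw [one_smul, ← hodd, ← key n t ht] at h2
    exact h2.congr (key n) (key n t ht)
  refine ⟨γ, fun t ↦ ?_, fun t ↦ ?_, ?_, ?_⟩
  · have h1 : (⌊t / T⌋ : ℝ) * T ≤ t := by
      rw [← le_div_iff₀ hT]; exact Int.floor_le _
    have h2 : t < (⌊t / T⌋ + 1) * T := by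
      rw [← div_lt_iff₀ hT]; exact Int.lt_floor_add_one _
    rcases h1.lt_or_eq with h | h
    · exact (hder _ t ⟨h1, h2.le⟩).hasDerivAt (Icc_mem_nhds h h2)
    · generalize ⌊t / T⌋ = n at h1 h2 h
      have hl := hder (n - 1) t (by push_cast; constructor <;> nlinarith)
      have hr := hder n t ⟨h1, h2.le⟩
      have hu := hl.union hr
      push_cast at hu
      rw [sub_add_cancel, Icc_union_Icc_eq_Icc (by nlinarith) (by nlinarith)] at hu
      exact hu.hasDerivAt (Icc_mem_nhds (by nlinarith) h2)
  · have h1 : (t + 2 * T) / T = t / T + (2 : ℤ) := by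
      push_cast; field_simp
    simp only [γ, h1, Int.floor_add_intCast]
    rw [zpow_add₀ (by norm_num)]
    push_cast
    rw [show t + 2 * T - ((⌊t / T⌋ : ℝ) + 2) * T = t - ⌊t / T⌋ * T by ring]
    norm_num
  · have h := key 0 0 (by simp [hT.le])
    simpa using h
  · have h := key 0 T (by simp [hT.le])
    simpa using h

theorem eventually_pos_nhdsGT_of_hasDerivWithinAt {f : ℝ → ℝ} {f' a b : ℝ} {t : ℝ}
    (ht : t ∈ Ico a b) (hf : HasDerivWithinAt f f' (Icc a b) t) (h0 : f t = 0) (hf' : 0 < f') :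
    ∀ᶠ u in 𝓝[>] t, 0 < f u := by
  have h1 : HasDerivWithinAt f f' (Ioi t) t :=
    (hf.mono_of_mem_nhdsWithin (Icc_mem_nhdsGE_of_mem ht)).mono Ioi_subset_Ici_self
  rw [hasDerivWithinAt_iff_tendsto_slope' self_notMem_Ioi] at h1
  filter_upwards [h1.eventually (lt_mem_nhds hf'), self_mem_nhdsWithin] with u hu hut
  rw [slope_def_field, h0, sub_zero] at hu
  exact (div_pos_iff_of_pos_right (sub_pos.2 hut)).1 hu

/-- A function that does not decrease where it is negative stays nonnegative. -/
theorem nonneg_of_hasDerivWithinAt_of_neg {f f' : ℝ → ℝ} {T : ℝ}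
    (hf : ∀ t ∈ Icc 0 T, HasDerivWithinAt f (f' t) (Icc 0 T) t) (h0 : 0 ≤ f 0)
    (hneg : ∀ t ∈ Icc 0 T, f t < 0 → 0 ≤ f' t) : ∀ t ∈ Icc 0 T, 0 ≤ f t := by
  intro t ht
  have key : ∀ ε : ℝ, 0 < ε → -f t ≤ ε * (1 + t) := by
    intro ε hε
    refine image_le_of_deriv_right_lt_deriv_boundary' (f := fun s ↦ -f s) (f' := fun s ↦ -f' s)
      (B := fun s ↦ ε * (1 + s)) (B' := fun _ ↦ ε) (a := 0) (b := T)
      (fun s hs ↦ (hf s hs).continuousWithinAt.neg) (fun s hs ↦ ?_) (by simp; linarith)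
      (by fun_prop) (fun s _ ↦ ?_) (fun s hs hB ↦ ?_) ht
    · exact ((hf s (Ico_subset_Icc_self hs)).mono_of_mem_nhdsWithin
        (Icc_mem_nhdsGE_of_mem hs)).neg
    · simpa using (((hasDerivAt_id s).const_add 1).const_mul ε).hasDerivWithinAt
    · have hpos : 0 < ε * (1 + s) := mul_pos hε (by linarith [hs.1])
      have := hneg s (Ico_subset_Icc_self hs) (by linarith)
      linarith
  by_contra! hlt
  have h1 : 0 < 1 + t := by linarith [ht.1]
  have h2 := key (-f t / (2 * (1 + t))) (by apply div_pos <;> linarith)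
  rw [div_mul_eq_mul_div, le_div_iff₀ (by linarith)] at h2
  nlinarith

/-- The vector field of the quintic system. -/
def quinticField (b : ℝ) (p : ℝ × ℝ) : ℝ × ℝ :=
  (p.2, -p.1 + (b ^ 2 - p.1 ^ 2) * (p.2 + p.2 ^ 3))

/-- The projection of the plane onto the rectangle `[-600, 600] × [0, 18]`. -/
def clampRect (p : ℝ × ℝ) : ℝ × ℝ :=
  (max (-600) (min 600 p.1), max 0 (min 18 p.2))

theorem clampRect_mem (p : ℝ × ℝ) : clampRect p ∈ Icc (-600 : ℝ) 600 ×ˢ Icc (0 : ℝ) 18 := by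
  simp [clampRect]

theorem clampRect_of_mem {p : ℝ × ℝ} (hp : p ∈ Icc (-600 : ℝ) 600 ×ˢ Icc (0 : ℝ) 18) :
    clampRect p = p := by
  obtain ⟨⟨h1, h2⟩, h3, h4⟩ := hp
  simp [clampRect, h1, h2, h3, h4]

theorem lipschitzWith_clampRect : LipschitzWith 1 clampRect := by
  have h := ((LipschitzWith.prod_fst (α := ℝ) (β := ℝ)).const_min 600 |>.const_max (-600)).prodMk
    ((LipschitzWith.prod_snd (α := ℝ) (β := ℝ)).const_min 18 |>.const_max 0)
  rw [max_self] at h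
  exact h

theorem exists_flow_quinticField_clampRect (b : ℝ) (p₀ : ℝ × ℝ) (r : NNReal) {T : ℝ}
    (hT : 0 ≤ T) :
    ∃ φ : (ℝ × ℝ) × ℝ → ℝ × ℝ,
      (∀ p ∈ Metric.closedBall p₀ r, φ (p, 0) = p ∧ ∀ t ∈ Icc 0 T,
        HasDerivWithinAt (fun s ↦ φ (p, s)) (quinticField b (clampRect (φ (p, t)))) (Icc 0 T) t) ∧
      ContinuousOn φ (Metric.closedBall p₀ r ×ˢ Icc 0 T) := by
  have hcompact : IsCompact (Icc (-600 : ℝ) 600 ×ˢ Icc (0 : ℝ) 18) :=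
    isCompact_Icc.prod isCompact_Icc
  have hsmooth : ContDiff ℝ 1 (quinticField b) := by
    unfold quinticField
    fun_prop
  obtain ⟨K, hK⟩ := hsmooth.contDiffOn.exists_lipschitzOnWith one_ne_zero
    ((convex_Icc _ _).prod (convex_Icc _ _)) hcompact
  obtain ⟨C, hC⟩ := hcompact.exists_bound_of_continuousOn hsmooth.continuous.continuousOn
  have hLip : LipschitzWith (K * 1) (fun p ↦ quinticField b (clampRect p)) := by
    rw [← lipschitzOnWith_univ]
    exact hK.comp lipschitzWith_clampRect.lipschitzOnWith fun p _ ↦ clampRect_mem p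
  refine exists_continuousOn_flow hLip (L := C.toNNReal) (fun p ↦ ?_) p₀ r hT
  exact (hC _ (clampRect_mem p)).trans (Real.le_coe_toNNReal C)

theorem hyperbola_transversal {b x : ℝ} (hb0 : 0 < b) (hb1 : b ≤ 65349 / 100000) :
    0 < 9 / 4 + x * (3 / 4 - x) ^ 3 -
      3 / 2 * (b ^ 2 - x ^ 2) * ((3 / 4 - x) ^ 2 + 9 / 4) := by
  have hb : b ^ 2 ≤ 4271 / 10000 := by nlinarith
  have h1 : (b ^ 2 - x ^ 2) * ((3 / 4 - x) ^ 2 + 9 / 4) ≤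
      (4271 / 10000 - x ^ 2) * ((3 / 4 - x) ^ 2 + 9 / 4) := by gcongr
  nlinarith [sq_nonneg (x ^ 2 + x / 2), sq_nonneg (x ^ 2 + x), sq_nonneg (x ^ 2 - x / 2),
    sq_nonneg (x + 1 / 3), sq_nonneg (x ^ 2), sq_nonneg (x ^ 2 - 1 / 9), sq_nonneg x]

section Trajectory

variable {b T : ℝ} {γ : ℝ → ℝ × ℝ}

theorem fst_snd_hasDerivWithinAt {v : ℝ × ℝ} {t : ℝ} {s : Set ℝ} (h : HasDerivWithinAt γ v s t) :
    HasDerivWithinAt (fun s ↦ (γ s).1) v.1 s t ∧ HasDerivWithinAt (fun s ↦ (γ s).2) v.2 s t :=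
  ⟨(ContinuousLinearMap.fst ℝ ℝ ℝ).hasFDerivAt.comp_hasDerivWithinAt t h,
    (ContinuousLinearMap.snd ℝ ℝ ℝ).hasFDerivAt.comp_hasDerivWithinAt t h⟩

/-- Trajectories of the clamped field starting on the negative `x`-axis stay in the rectangle, where
the field is the original one, as long as they stay in the upper half-plane. -/
theorem mem_rect_of_upper (hb0 : 0 < b) (hb1 : b ≤ 65349 / 100000)
    (hγ : ∀ t ∈ Icc 0 T, HasDerivWithinAt γ (quinticField b (clampRect (γ t))) (Icc 0 T) t)
    (h0 : (γ 0).1 ∈ Icc (-600 : ℝ) 0) (h0' : (γ 0).2 = 0)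
    (hup : ∀ t ∈ Icc 0 T, 0 ≤ (γ t).2) :
    ∀ t ∈ Icc 0 T, γ t ∈ Icc (-600 : ℝ) 600 ×ˢ Icc (0 : ℝ) 18 := by
  have hx : ∀ t ∈ Icc 0 T, HasDerivWithinAt (fun s ↦ (γ s).1) (clampRect (γ t)).2 (Icc 0 T) t :=
    fun t ht ↦ (fst_snd_hasDerivWithinAt (hγ t ht)).1
  have hy : ∀ t ∈ Icc 0 T, HasDerivWithinAt (fun s ↦ (γ s).2)
      (quinticField b (clampRect (γ t))).2 (Icc 0 T) t :=
    fun t ht ↦ (fst_snd_hasDerivWithinAt (hγ t ht)).2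
  have hxc : ContinuousOn (fun s ↦ (γ s).1) (Icc 0 T) := fun t ht ↦ (hx t ht).continuousWithinAt
  have hyc : ContinuousOn (fun s ↦ (γ s).2) (Icc 0 T) := fun t ht ↦ (hy t ht).continuousWithinAt
  have hx' : ∀ t ∈ Ico 0 T, HasDerivWithinAt (fun s ↦ (γ s).1) (clampRect (γ t)).2 (Ici t) t :=
    fun t ht ↦ (hx t (Ico_subset_Icc_self ht)).mono_of_mem_nhdsWithin (Icc_mem_nhdsGE_of_mem ht)
  have hy' : ∀ t ∈ Ico 0 T, HasDerivWithinAt (fun s ↦ (γ s).2)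
      (quinticField b (clampRect (γ t))).2 (Ici t) t :=
    fun t ht ↦ (hy t (Ico_subset_Icc_self ht)).mono_of_mem_nhdsWithin (Icc_mem_nhdsGE_of_mem ht)
  have hmono : MonotoneOn (fun s ↦ (γ s).1) (Icc 0 T) :=
    monotoneOn_of_hasDerivWithinAt_nonneg (convex_Icc _ _) hxc
      (fun t ht ↦ (hx t (interior_subset ht)).mono interior_subset)
      (fun t _ ↦ (clampRect_mem (γ t)).2.1)
  have hlow : ∀ t ∈ Icc 0 T, -600 ≤ (γ t).1 := fun t ht ↦
    h0.1.trans (hmono ⟨le_rfl, ht.1.trans ht.2⟩ ht ht.1)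
  have hleft : ∀ t ∈ Icc 0 T, (γ t).1 ≤ 2 / 3 → (γ t).2 ≤ 18 := by
    intro t ht hxt
    have hsub : ∀ s ∈ Ico 0 t, s ∈ Ico 0 T := fun s hs ↦ ⟨hs.1, hs.2.trans_le ht.2⟩
    have hcl : Icc 0 t ⊆ Icc 0 T := Icc_subset_Icc_right ht.2
    have h : (γ t).2 * (3 / 4 - (γ t).1) ≤ 3 / 2 := by
      refine image_le_of_deriv_right_lt_deriv_boundary'
        (f := fun s ↦ (γ s).2 * (3 / 4 - (γ s).1)) (B := fun _ ↦ 3 / 2) (B' := fun _ ↦ 0)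
        ((hyc.mono hcl).mul (continuousOn_const.sub (hxc.mono hcl)))
        (fun s hs ↦ (hy' s (hsub s hs)).mul ((hx' s (hsub s hs)).const_sub _)) (by norm_num [h0'])
        continuousOn_const (fun s _ ↦ hasDerivWithinAt_const _ _ _) (fun s hs hB ↦ ?_)
        (⟨ht.1, le_rfl⟩ : t ∈ Icc 0 t)
      have hsT := Ico_subset_Icc_self (hsub s hs)
      have hxs : (γ s).1 ≤ 2 / 3 := (hmono hsT ht hs.2.le).trans hxt
      have hys := hup s hsT
      have hmem : γ s ∈ Icc (-600 : ℝ) 600 ×ˢ Icc (0 : ℝ) 18 :=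
        ⟨⟨hlow s hsT, by linarith⟩, hys, by nlinarith⟩
      rw [clampRect_of_mem hmem]
      simp only [quinticField]
      generalize (γ s).1 = x at *
      generalize (γ s).2 = y at *
      have hw : 0 < 3 / 4 - x := by linarith
      have hq := hyperbola_transversal (x := x) hb0 hb1
      have hy2 : y * (3 / 4 - x) = 3 / 2 := hB
      have : 9 / 4 + x * (3 / 4 - x) ^ 3 -
          3 / 2 * (b ^ 2 - x ^ 2) * ((3 / 4 - x) ^ 2 + 9 / 4) =
          -((-x + (b ^ 2 - x ^ 2) * (y + y ^ 3)) * (3 / 4 - x) + y * -y) * (3 / 4 - x) ^ 2 := by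
        have h9 : (9 / 4 : ℝ) = (y * (3 / 4 - x)) ^ 2 := by rw [hy2]; norm_num
        rw [h9, ← hy2]; ring
      rw [this] at hq
      have := (pos_iff_pos_of_mul_pos hq).2 (by positivity)
      linarith
    nlinarith [hup t ht]
  have hline : ∀ t ∈ Icc 0 T, 2 / 3 ≤ (γ t).1 → (γ t).2 ≤ 18 - ((γ t).1 - 2 / 3) / 30 := by
    intro t ht hxt
    obtain ⟨s, hs, hxs⟩ := intermediate_value_Icc ht.1
      (hxc.mono (Icc_subset_Icc_right ht.2)) (show (2 / 3 : ℝ) ∈ _ from ⟨by linarith [h0.2], hxt⟩)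
    have hsT : s ∈ Icc 0 T := ⟨hs.1, hs.2.trans ht.2⟩
    have hsub : ∀ u ∈ Ico s t, u ∈ Ico 0 T := fun u hu ↦
      ⟨hs.1.trans hu.1, hu.2.trans_le ht.2⟩
    have hcl : Icc s t ⊆ Icc 0 T := Icc_subset_Icc hs.1 ht.2
    simp only at hxs
    refine image_le_of_deriv_right_lt_deriv_boundary'
      (f := fun s ↦ (γ s).2) (B := fun s ↦ 18 - ((γ s).1 - 2 / 3) / 30)
      (hyc.mono hcl) (fun u hu ↦ hy' u (hsub u hu)) ?_
      (continuousOn_const.sub (((hxc.mono hcl).sub continuousOn_const).div_const _))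
      (fun u hu ↦ (((hx' u (hsub u hu)).sub_const _).div_const _).const_sub _)
      (fun u hu hB ↦ ?_) (⟨hs.2, le_rfl⟩ : t ∈ Icc s t)
    · simpa [hxs] using hleft s hsT hxs.le
    · have huT := Ico_subset_Icc_self (hsub u hu)
      have hxu : 2 / 3 ≤ (γ u).1 := hxs ▸ hmono hsT huT hu.1
      have hyu := hup u huT
      have hmem : γ u ∈ Icc (-600 : ℝ) 600 ×ˢ Icc (0 : ℝ) 18 :=
        ⟨⟨by linarith, by linarith⟩, hyu, by linarith⟩
      rw [clampRect_of_mem hmem]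
      simp only [quinticField]
      generalize (γ u).1 = x at *
      generalize (γ u).2 = y at *
      have h1 : 0 ≤ (x ^ 2 - b ^ 2) * (y + y ^ 3) :=
        mul_nonneg (by nlinarith) (by positivity)
      nlinarith
  intro t ht
  have hyt := hup t ht
  rcases le_total (γ t).1 (2 / 3) with h | h
  · exact ⟨⟨hlow t ht, by linarith⟩, hyt, hleft t ht h⟩
  · have := hline t ht h
    exact ⟨⟨hlow t ht, by linarith⟩, hyt, by linarith⟩

theorem sq_le_sq_add_sq
    (hγ : ∀ t ∈ Icc 0 T, HasDerivWithinAt γ (quinticField b (γ t)) (Icc 0 T) t)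
    (h0 : b ^ 2 ≤ (γ 0).1 ^ 2 + (γ 0).2 ^ 2) :
    ∀ t ∈ Icc 0 T, b ^ 2 ≤ (γ t).1 ^ 2 + (γ t).2 ^ 2 := by
  intro t ht
  have h := nonneg_of_hasDerivWithinAt_of_neg
    (f := fun t ↦ (γ t).1 ^ 2 + (γ t).2 ^ 2 - b ^ 2)
    (fun t ht ↦ (((fst_snd_hasDerivWithinAt (hγ t ht)).1.pow 2).add
      ((fst_snd_hasDerivWithinAt (hγ t ht)).2.pow 2)).sub_const (b ^ 2))
    (by linarith) (fun t _ hneg ↦ ?_) t ht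
  · linarith
  · simp only [quinticField] at hneg ⊢
    generalize (γ t).1 = x at *
    generalize (γ t).2 = y at *
    have h1 : 0 ≤ (b ^ 2 - x ^ 2) * (y ^ 2 + y ^ 4) :=
      mul_nonneg (by nlinarith) (by positivity)
    push_cast
    nlinarith

/-- A trajectory in the upper half of the rectangle and outside the disk of radius `b` leaves this
region after a bounded time. -/
theorem time_le_of_mem_rect (hb0 : 0 < b) (hb1 : b ≤ 1) (hT : 0 ≤ T)
    (hγ : ∀ t ∈ Icc 0 T, HasDerivWithinAt γ (quinticField b (γ t)) (Icc 0 T) t)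
    (hmem : ∀ t ∈ Icc 0 T, γ t ∈ Icc (-600 : ℝ) 600 ×ˢ Icc (0 : ℝ) 18)
    (hout : ∀ t ∈ Icc 0 T, b ^ 2 ≤ (γ t).1 ^ 2 + (γ t).2 ^ 2) :
    T ≤ 10 ^ 16 / b ^ 2 := by
  have hder : ∀ t ∈ Icc 0 T, HasDerivWithinAt
      (fun t ↦ 10 ^ 11 * (γ t).1 - (γ t).1 * (γ t).2 - b ^ 2 / 18 * t) _ (Icc 0 T) t :=
    fun t ht ↦ (((fst_snd_hasDerivWithinAt (hγ t ht)).1.const_mul (10 ^ 11)).sub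
      ((fst_snd_hasDerivWithinAt (hγ t ht)).1.mul (fst_snd_hasDerivWithinAt (hγ t ht)).2)).sub
      ((hasDerivWithinAt_id t _).const_mul (b ^ 2 / 18))
  have hmono := monotoneOn_of_hasDerivWithinAt_nonneg (convex_Icc 0 T)
    (fun t ht ↦ (hder t ht).continuousWithinAt)
    (fun t ht ↦ (hder t (interior_subset ht)).mono interior_subset) (fun t ht ↦ ?_)
  · have h := hmono (left_mem_Icc.2 hT) (right_mem_Icc.2 hT) hT
    obtain ⟨⟨h1, h2⟩, h3, h4⟩ := hmem 0 (left_mem_Icc.2 hT)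
    obtain ⟨⟨h5, h6⟩, h7, h8⟩ := hmem T (right_mem_Icc.2 hT)
    have h9 : (γ 0).1 * (γ 0).2 ≤ 600 * 18 := mul_le_mul h2 h4 h3 (by norm_num)
    have h10 : -(γ T).1 * (γ T).2 ≤ 600 * 18 := mul_le_mul (by linarith) h8 h7 (by norm_num)
    rw [le_div_iff₀ (by positivity)]
    simp only at h
    linarith
  · obtain ⟨⟨h1, h2⟩, h3, h4⟩ := hmem t (interior_subset ht)
    have h5 := hout t (interior_subset ht)
    simp only [quinticField]
    generalize (γ t).1 = x at *
    generalize (γ t).2 = y at *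
    have hx2 : x ^ 2 ≤ 360000 := by nlinarith
    have hxb : |b ^ 2 - x ^ 2| ≤ 360001 := abs_le.2 ⟨by nlinarith, by nlinarith⟩
    have hprod : |x * ((b ^ 2 - x ^ 2) * (1 + y ^ 2))| ≤ 600 * (360001 * 325) := by
      rw [abs_mul, abs_mul, abs_of_nonneg (show 0 ≤ 1 + y ^ 2 by positivity)]
      gcongr
      · exact abs_le.2 ⟨h1, h2⟩
      · nlinarith
    have h6 := (abs_le.1 hprod).2
    have h7 : 0 ≤ y * (10 ^ 11 - y - x * ((b ^ 2 - x ^ 2) * (1 + y ^ 2)) - 1) :=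
      mul_nonneg h3 (by linarith)
    nlinarith

/-- While it stays in the upper half-plane, a trajectory of the clamped field starting on the
negative `x`-axis outside the disk of radius `b` is a trajectory of the original field, inside the
rectangle and outside the disk. -/
theorem isTrajectory_of_upper (hb0 : 0 < b) (hb1 : b ≤ 65349 / 100000)
    (hγ : ∀ t ∈ Icc 0 T, HasDerivWithinAt γ (quinticField b (clampRect (γ t))) (Icc 0 T) t)
    (h0 : (γ 0).1 ∈ Icc (-600) (-b)) (h0' : (γ 0).2 = 0) {t : ℝ} (htT : t ≤ T)
    (hup : ∀ s ∈ Icc 0 t, 0 ≤ (γ s).2) :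
    (∀ s ∈ Icc 0 t, HasDerivWithinAt γ (quinticField b (γ s)) (Icc 0 t) s) ∧
      (∀ s ∈ Icc 0 t, γ s ∈ Icc (-600 : ℝ) 600 ×ˢ Icc (0 : ℝ) 18) ∧
      ∀ s ∈ Icc 0 t, b ^ 2 ≤ (γ s).1 ^ 2 + (γ s).2 ^ 2 := by
  have hcl : Icc 0 t ⊆ Icc 0 T := Icc_subset_Icc_right htT
  have hγ' : ∀ s ∈ Icc 0 t,
      HasDerivWithinAt γ (quinticField b (clampRect (γ s))) (Icc 0 t) s :=
    fun s hs ↦ (hγ s (hcl hs)).mono hcl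
  have hmem := mem_rect_of_upper hb0 hb1 hγ' ⟨h0.1, h0.2.trans (by linarith)⟩ h0' hup
  have hfield : ∀ s ∈ Icc 0 t, HasDerivWithinAt γ (quinticField b (γ s)) (Icc 0 t) s := by
    intro s hs
    have h := hγ' s hs
    rwa [clampRect_of_mem (hmem s hs)] at h
  exact ⟨hfield, hmem, sq_le_sq_add_sq hfield (by nlinarith [h0.2])⟩

/-- The trajectory from `(-c, 0)` with `b ≤ c` crosses the upper half-plane and hits the positive
`x`-axis at distance at least `b` from the origin. -/
theorem exists_return_time (hb0 : 0 < b) (hb1 : b ≤ 65349 / 100000) (hT : 10 ^ 16 / b ^ 2 < T)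
    (hγ : ∀ t ∈ Icc 0 T, HasDerivWithinAt γ (quinticField b (clampRect (γ t))) (Icc 0 T) t)
    (h0 : (γ 0).1 ∈ Icc (-600) (-b)) (h0' : (γ 0).2 = 0) :
    ∃ t ∈ Icc 0 T, (∀ s ∈ Icc 0 t, 0 ≤ (γ s).2) ∧ (γ t).2 = 0 ∧ b ≤ (γ t).1 := by
  have hT0 : 0 < T := lt_of_le_of_lt (by positivity) hT
  have hyc : ContinuousOn (fun s ↦ (γ s).2) (Icc 0 T) :=
    fun t ht ↦ (fst_snd_hasDerivWithinAt (hγ t ht)).2.continuousWithinAt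
  let P : Set ℝ := {t ∈ Icc 0 T | ∀ s ∈ Icc 0 t, 0 ≤ (γ s).2}
  have hP0 : (0 : ℝ) ∈ P := by
    refine ⟨⟨le_rfl, hT0.le⟩, fun s hs ↦ ?_⟩
    rw [Icc_self, mem_singleton_iff] at hs
    rw [hs, h0']
  have hPbdd : BddAbove P := ⟨T, fun t ht ↦ ht.1.2⟩
  have hτ0 : 0 ≤ sSup P := le_csSup hPbdd hP0
  have hτT : sSup P ≤ T := csSup_le ⟨0, hP0⟩ fun t ht ↦ ht.1.2
  set τ := sSup P with hτ
  have hlt : ∀ s ∈ Ico 0 τ, 0 ≤ (γ s).2 := by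
    intro s hs
    obtain ⟨t, ht, hst⟩ := exists_lt_of_lt_csSup ⟨0, hP0⟩ hs.2
    exact ht.2 s ⟨hs.1, hst.le⟩
  have hup : ∀ s ∈ Icc 0 τ, 0 ≤ (γ s).2 := by
    rcases hτ0.eq_or_lt with h | h
    · rw [← h]
      exact hP0.2
    · have hcl : closure (Ico 0 τ) = Icc 0 τ := closure_Ico h.ne
      intro s hs
      have hmaps : MapsTo (fun s ↦ (γ s).2) (Ico 0 τ) (Ici 0) := hlt
      have := hmaps.closure_of_continuousOn
        (hcl ▸ hyc.mono (Icc_subset_Icc_right hτT))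
      rw [hcl, closure_Ici] at this
      exact this hs
  obtain ⟨hfield, hmem, hout⟩ := isTrajectory_of_upper hb0 hb1 hγ h0 h0' hτT hup
  have hτltT : τ < T :=
    (time_le_of_mem_rect hb0 (by linarith) hτ0 hfield hmem hout).trans_lt hT
  have hnot : ¬ ∀ᶠ u in 𝓝[>] τ, 0 < (γ u).2 := by
    intro hev
    obtain ⟨u, hu, hsub⟩ := mem_nhdsGT_iff_exists_Ioo_subset.1 hev
    obtain ⟨v, hv1, hv2⟩ := exists_between (lt_min hu hτltT)
    have hvP : v ∈ P := by
      refine ⟨⟨hτ0.trans hv1.le, hv2.le.trans (min_le_right _ _)⟩, fun s hs ↦ ?_⟩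
      rcases le_or_gt s τ with h | h
      · exact hup s ⟨hs.1, h⟩
      · exact (hsub ⟨h, hs.2.trans_lt (hv2.trans_le (min_le_left _ _))⟩ : 0 < (γ s).2).le
    exact absurd (le_csSup hPbdd hvP) (not_le.2 hv1)
  have hτIcc : τ ∈ Icc 0 τ := ⟨hτ0, le_rfl⟩
  have hτy : (γ τ).2 = 0 := by
    refine le_antisymm (not_lt.1 fun hpos ↦ hnot ?_) (hup τ hτIcc)
    have hc : ContinuousWithinAt (fun s ↦ (γ s).2) (Ioi τ) τ :=
      ((hyc τ ⟨hτ0, hτT⟩).mono_of_mem_nhdsWithin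
        (Icc_mem_nhdsGE_of_mem ⟨hτ0, hτltT⟩)).mono Ioi_subset_Ici_self
    exact hc.eventually (lt_mem_nhds hpos)
  refine ⟨τ, ⟨hτ0, hτT⟩, hup, hτy, ?_⟩
  have hxnonneg : 0 ≤ (γ τ).1 := by
    by_contra! hneg
    have hd := (fst_snd_hasDerivWithinAt (hγ τ ⟨hτ0, hτT⟩)).2
    rw [clampRect_of_mem (hmem τ hτIcc)] at hd
    refine hnot (eventually_pos_nhdsGT_of_hasDerivWithinAt ⟨hτ0, hτltT⟩ hd hτy ?_)
    simp [quinticField, hτy, hneg]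
  have h := hout τ hτIcc
  rw [hτy] at h
  nlinarith

/-- A trajectory in the upper half-plane that hits the positive `x`-axis does so at its end. -/
theorem return_time_unique (hb0 : 0 < b)
    (hγ : ∀ t ∈ Icc 0 T, HasDerivWithinAt γ (quinticField b (γ t)) (Icc 0 T) t)
    (hup : ∀ s ∈ Icc 0 T, 0 ≤ (γ s).2) {t : ℝ} (ht : t ∈ Icc 0 T) (hty : (γ t).2 = 0)
    (htx : b ≤ (γ t).1) : t = T := by
  by_contra hne
  have htT : t < T := lt_of_le_of_ne ht.2 hne
  have hd := (fst_snd_hasDerivWithinAt (hγ t ht)).2.neg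
  have hev := eventually_pos_nhdsGT_of_hasDerivWithinAt ⟨ht.1, htT⟩ hd (by simp [hty])
    (by simp only [quinticField, hty]; linarith)
  obtain ⟨u, hu, huT, hut⟩ :=
    (hev.and ((eventually_nhdsWithin_of_eventually_nhds (eventually_lt_nhds htT)).and
      eventually_mem_nhdsWithin)).exists
  have := hup u ⟨ht.1.trans (le_of_lt hut), le_of_lt huT⟩
  simp only [Pi.neg_apply] at hu
  linarith

end Trajectory

/-- Some trajectory of the quintic system goes from `(-c, 0)` to `(c, 0)`. -/
theorem exists_antipodal_arc {b : ℝ} (hb0 : 0 < b) (hb1 : b ≤ 65349 / 100000) :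
    ∃ (γ : ℝ → ℝ × ℝ) (T c : ℝ), 0 < T ∧ 0 < c ∧ γ 0 = (-c, 0) ∧ γ T = (c, 0) ∧
      ∀ t ∈ Icc 0 T, HasDerivWithinAt γ (quinticField b (γ t)) (Icc 0 T) t := by
  set T : ℝ := 10 ^ 16 / b ^ 2 + 1 with hTdef
  have hT0 : 0 ≤ T := by positivity
  obtain ⟨φ, hφ, hφc⟩ := exists_flow_quinticField_clampRect b (-300, 0) 300 hT0
  have hball : ∀ c ∈ Icc b 600, ((-c, 0) : ℝ × ℝ) ∈ Metric.closedBall (-300, 0) (300 : NNReal) := by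
    intro c hc
    rw [mem_closedBall_iff_norm, Prod.norm_def]
    simp only [Prod.fst_sub, Prod.snd_sub, sub_zero, norm_zero, Real.norm_eq_abs]
    refine max_le (abs_le.2 ⟨?_, ?_⟩) (by simp) <;> push_cast <;> linarith [hc.1, hc.2]
  let ψ : ℝ × ℝ → ℝ × ℝ := fun q ↦ φ ((-q.1, 0), q.2)
  let Q : Set (ℝ × ℝ) := Icc b 600 ×ˢ Icc 0 T
  have hψc : ContinuousOn ψ Q :=
    hφc.comp (by fun_prop) fun q hq ↦ ⟨hball _ hq.1, hq.2⟩
  have hQc : IsClosed Q := isClosed_Icc.prod isClosed_Icc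
  let S : Set (ℝ × ℝ) :=
    {q ∈ Q | (∀ s ∈ Icc 0 q.2, 0 ≤ (ψ (q.1, s)).2) ∧ (ψ q).2 = 0 ∧ b ≤ (ψ q).1}
  have hSc : IsCompact S := by
    refine (isCompact_Icc.prod isCompact_Icc).of_isClosed_subset ?_ (sep_subset Q _)
    have hS : S = (Q ∩ (fun q ↦ (ψ q).2) ⁻¹' {0}) ∩ (Q ∩ (fun q ↦ (ψ q).1) ⁻¹' Ici b) ∩
        ⋂ u ∈ Icc 0 T, Q ∩ (fun q ↦ (ψ (q.1, min u q.2)).2) ⁻¹' Ici 0 := by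
      ext q
      simp only [S, mem_ofPred_eq, mem_inter_iff, mem_preimage, mem_singleton_iff, mem_Ici,
        mem_iInter]
      constructor
      · rintro ⟨hq, h1, h2, h3⟩
        exact ⟨⟨⟨hq, h2⟩, hq, h3⟩, fun u hu ↦
          ⟨hq, h1 _ ⟨le_min hu.1 hq.2.1, min_le_right _ _⟩⟩⟩
      · rintro ⟨⟨⟨hq, h2⟩, -, h3⟩, h1⟩
        refine ⟨hq, fun s hs ↦ ?_, h2, h3⟩
        have := (h1 s ⟨hs.1, hs.2.trans hq.2.2⟩).2
        rwa [min_eq_left hs.2] at this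
    rw [hS]
    refine ((hψc.snd.preimage_isClosed_of_isClosed hQc isClosed_singleton).inter
      (hψc.fst.preimage_isClosed_of_isClosed hQc isClosed_Ici)).inter
      (isClosed_biInter fun u hu ↦ ContinuousOn.preimage_isClosed_of_isClosed ?_ hQc isClosed_Ici)
    exact (hψc.comp (by fun_prop) fun q hq ↦
      ⟨hq.1, le_min hu.1 hq.2.1, (min_le_left _ _).trans hu.2⟩).snd
  have hψS : ContinuousOn (fun q ↦ (ψ q).1) S := (hψc.mono (sep_subset Q _)).fst
  have hA : IsCompact (Prod.fst '' {q ∈ S | q.1 ≤ (ψ q).1}) := by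
    refine (hSc.of_isClosed_subset ?_ (sep_subset S _)).image continuous_fst
    exact hSc.isClosed.isClosed_le continuousOn_fst hψS
  have hB : IsCompact (Prod.fst '' {q ∈ S | (ψ q).1 ≤ q.1}) := by
    refine (hSc.of_isClosed_subset ?_ (sep_subset S _)).image continuous_fst
    exact hSc.isClosed.isClosed_le hψS continuousOn_fst
  have hflow : ∀ c ∈ Icc b 600, ψ (c, 0) = (-c, 0) ∧ ∀ t ∈ Icc 0 T,
      HasDerivWithinAt (fun s ↦ ψ (c, s)) (quinticField b (clampRect (ψ (c, t)))) (Icc 0 T) t :=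
    fun c hc ↦ hφ _ (hball c hc)
  have htraj : ∀ c ∈ Icc b 600, ∀ t ≤ T, (∀ s ∈ Icc 0 t, 0 ≤ (ψ (c, s)).2) →
      (∀ s ∈ Icc 0 t, HasDerivWithinAt (fun s ↦ ψ (c, s)) (quinticField b (ψ (c, s)))
        (Icc 0 t) s) ∧
      (∀ s ∈ Icc 0 t, ψ (c, s) ∈ Icc (-600 : ℝ) 600 ×ˢ Icc (0 : ℝ) 18) := by
    intro c hc t ht hup
    have h := isTrajectory_of_upper hb0 hb1 (hflow c hc).2
      (by rw [(hflow c hc).1]; exact ⟨neg_le_neg hc.2, neg_le_neg hc.1⟩)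
      (by rw [(hflow c hc).1]) ht hup
    exact ⟨h.1, h.2.1⟩
  have hret : ∀ c ∈ Icc b 600, ∃ t, (c, t) ∈ S := by
    intro c hc
    obtain ⟨t, ht, h⟩ := exists_return_time hb0 hb1 (lt_add_one _) (hflow c hc).2
      (by rw [(hflow c hc).1]; exact ⟨neg_le_neg hc.2, neg_le_neg hc.1⟩)
      (by rw [(hflow c hc).1])
    exact ⟨t, ⟨hc, ht⟩, h⟩
  have hle : ∀ q ∈ S, (ψ q).1 ≤ 600 := fun q hq ↦
    ((htraj q.1 hq.1.1 q.2 hq.1.2.2 hq.2.1).2 q.2 ⟨hq.1.2.1, le_rfl⟩).1.2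
  have hbmem : b ∈ Icc b 600 := ⟨le_rfl, by linarith⟩
  have h600mem : (600 : ℝ) ∈ Icc b 600 := ⟨by linarith, le_rfl⟩
  obtain ⟨c, hc, ⟨⟨c₁, t₁⟩, ⟨h1, hle1⟩, hc1⟩, ⟨⟨c₂, t₂⟩, ⟨h2, hle2⟩, hc2⟩⟩ :=
    isPreconnected_closed_iff.1 isPreconnected_Icc _ _ hA.isClosed hB.isClosed
      (fun c hc ↦ by
        obtain ⟨t, ht⟩ := hret c hc
        exact (le_total c (ψ (c, t)).1).imp (fun h ↦ ⟨(c, t), ⟨ht, h⟩, rfl⟩)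
          fun h ↦ ⟨(c, t), ⟨ht, h⟩, rfl⟩)
      (by
        obtain ⟨t, ht⟩ := hret b hbmem
        exact ⟨b, hbmem, (b, t), ⟨ht, ht.2.2.2⟩, rfl⟩)
      (by
        obtain ⟨t, ht⟩ := hret 600 h600mem
        exact ⟨600, h600mem, (600, t), ⟨ht, hle _ ht⟩, rfl⟩)
  simp only at hc1 hc2 hle1 hle2
  subst hc1 hc2
  have htt : t₁ = t₂ := by
    rcases le_total t₁ t₂ with h | h
    · exact return_time_unique hb0 (htraj _ hc t₂ h2.1.2.2 h2.2.1).1 h2.2.1 ⟨h1.1.2.1, h⟩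
        h1.2.2.1 h1.2.2.2
    · exact (return_time_unique hb0 (htraj _ hc t₁ h1.1.2.2 h1.2.1).1 h1.2.1 ⟨h2.1.2.1, h⟩
        h2.2.2.1 h2.2.2.2).symm
  subst htt
  have hc0 := hb0.trans_le hc.1
  have hx : (ψ (c₂, t₁)).1 = c₂ := le_antisymm hle2 hle1
  have hend : ψ (c₂, t₁) = (c₂, 0) := Prod.ext hx h1.2.2.1
  refine ⟨fun s ↦ ψ (c₂, s), t₁, c₂, h1.1.2.1.lt_of_ne fun h ↦ ?_, hc0, (hflow _ hc).1, hend,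
    (htraj _ hc t₁ h1.1.2.2 h1.2.1).1⟩
  have h' : t₁ = 0 := h.symm
  rw [h', (hflow _ hc).1] at hx
  simp only at hx
  linarith

/-- For each `b` with `0 < b ≤ 65349/100000`, the quintic system
`ẋ = y, ẏ = -x + (b² - x²)(y + y³)` has at least one nonconstant periodic
solution. -/
theorem exists_periodic_orbit_quintic
    (b : ℝ) (hb0 : 0 < b) (hb1 : b ≤ 65349 / 100000) :
    ∃ (γ : ℝ → ℝ × ℝ) (T : ℝ), 0 < T ∧
      (∀ t : ℝ, HasDerivAt γ
        ((γ t).2, -(γ t).1 + (b ^ 2 - (γ t).1 ^ 2) * ((γ t).2 + (γ t).2 ^ 3)) t) ∧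
      (∀ t : ℝ, γ (t + T) = γ t) ∧
      (∃ t₁ t₂ : ℝ, γ t₁ ≠ γ t₂) := by
  obtain ⟨φ, T, c, hT, hc, h0, hend, hφ⟩ := exists_antipodal_arc hb0 hb1
  have hodd : ∀ p, quinticField b (-p) = -quinticField b p := fun p ↦ by
    ext <;> simp only [quinticField, Prod.fst_neg, Prod.snd_neg]; ring
  obtain ⟨γ, hγ, hper, hγ0, hγT⟩ :=
    exists_periodic_of_antipodal_arc hodd hT hφ (by rw [h0, hend]; simp)
  refine ⟨γ, 2 * T, by positivity, hγ, hper, 0, T, fun h ↦ ?_⟩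
  rw [hγ0, hγT, h0, hend] at h
  have := congrArg Prod.fst h
  simp only at this
  linarith
end

section
/- Let a₀ = 203/200 and define f(x,y) = 1 − x²/a₀² + (10a₀⁴ − 49a₀² + 40)xy/(5a₀²) + (200a₀⁸ − 1010a₀⁶ + 147a₀⁴ + 3800a₀² − 3300)y²/(100a₀²). Let P(x,y) = −y + 4x − (49/10)x³ − (26/5)xy² + (1/5)x²y² + x⁵ + 2x³y² + xy⁴ and Q(x,y) = x + 4y − (23/5)x²y − 5y³ − (1/5)xy³ − (2/15)y⁴ + x⁴y + 2x²y³ + y⁵, and set ḟ = P·∂f/∂x + Q·∂f/∂y. Then the set C = {(x,y) ∈ ℝ² : f(x,y) = 0} is nonempty and bounded (an ellipse), ḟ does not take both strictly positive and strictly negative values on C, and {p ∈ C : ḟ(p) = 0} is finite. -/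
/-- The defining polynomial of the ellipse at `a₀ = 203 / 200`. -/
noncomputable def ellipsePoly (x y : ℝ) : ℝ :=
  1 - 40000 / 41209 * x ^ 2 + 21217681 / 824180000 * (x * y)
    - 1385007837710472239 / 1318688000000000000 * y ^ 2

/-- On the ellipse, `ḟ = -y² * transversalityFactor`; the factor is a sum of two squares,
a positive constant and a small perturbation. -/
noncomputable def transversalityFactor (x y : ℝ) : ℝ :=
  1 / 50
    + (3259 / 5000
      + 321 / 1000 * y
      - 11499 / 10000 * y ^ 2
      + 2807 / 10000 * x) ^ 2
    + (-919 / 10000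
      - 839 / 10000 * y
      - 147 / 10000 * y ^ 2
      - 929 / 5000 * x
      + 691 / 625 * x * y) ^ 2
    + (-72520288335821618357277 / 1054950400000000000000000000
      - 2237871 / 250000000000 * y
      - 1889898076649368075914122948221954133 / 33758412800000000000000000000000000000000 * y ^ 2
      + 3500907449388441631604507 / 989016000000000000000000000000 * y ^ 3
      + 71877357833995149959 / 500000000000000000000000 * y ^ 4
      - 441 / 6250000 * x
      + 356265347273780389322506869 / 5274752000000000000000000000000 * x * y
      - 6428518144783039 / 309067500000000000000 * x * y ^ 2
      + 26660458439 / 312500000000000 * x * y ^ 3)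

theorem abs_le_of_ellipsePoly_eq_zero {x y : ℝ} (h : ellipsePoly x y = 0) :
    |x| ≤ 11 / 10 ∧ |y| ≤ 11 / 10 := by
  unfold ellipsePoly at h
  constructor <;> refine abs_le_of_sq_le_sq ?_ (by norm_num) <;>
    nlinarith [sq_nonneg (x - y), sq_nonneg (x + y), sq_nonneg x, sq_nonneg y]

theorem abs_monomial_le_two {x y : ℝ} (hx : |x| ≤ 11 / 10) (hy : |y| ≤ 11 / 10)
    (i j : ℕ) (hij : i + j ≤ 4) : |x ^ i * y ^ j| ≤ 2 := by
  rw [abs_mul, abs_pow, abs_pow]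
  calc |x| ^ i * |y| ^ j ≤ (11 / 10 : ℝ) ^ i * (11 / 10) ^ j := by gcongr
    _ = (11 / 10 : ℝ) ^ (i + j) := (pow_add _ _ _).symm
    _ ≤ (11 / 10 : ℝ) ^ 4 := pow_le_pow_right₀ (by norm_num) hij
    _ ≤ 2 := by norm_num

theorem transversalityFactor_pos {x y : ℝ} (h : ellipsePoly x y = 0) :
    0 < transversalityFactor x y := by
  obtain ⟨hx, hy⟩ := abs_le_of_ellipsePoly_eq_zero h
  have hm := fun i j hij => abs_le.mp (abs_monomial_le_two hx hy i j hij)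
  have h01 := hm 0 1 (by norm_num)
  have h02 := hm 0 2 (by norm_num)
  have h03 := hm 0 3 (by norm_num)
  have h04 := hm 0 4 (by norm_num)
  have h10 := hm 1 0 (by norm_num)
  have h11 := hm 1 1 (by norm_num)
  have h12 := hm 1 2 (by norm_num)
  have h13 := hm 1 3 (by norm_num)
  simp only [pow_zero, one_mul, mul_one, pow_one] at h01 h02 h03 h04 h10 h11 h12 h13
  unfold transversalityFactor
  linarith [sq_nonneg (3259 / 5000
      + 321 / 1000 * y
      - 11499 / 10000 * y ^ 2
      + 2807 / 10000 * x),
    sq_nonneg (-919 / 10000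
      - 839 / 10000 * y
      - 147 / 10000 * y ^ 2
      - 929 / 5000 * x
      + 691 / 625 * x * y)]

/-- The derivative of the ellipse polynomial along the quintic vector field, in closed form. -/
theorem orbital_derivative_eq (x y : ℝ) :
    (-y + 4 * x - (49 / 10) * x ^ 3 - (26 / 5) * x * y ^ 2 + (1 / 5) * x ^ 2 * y ^ 2
        + x ^ 5 + 2 * x ^ 3 * y ^ 2 + x * y ^ 4)
      * (2 * (-40000 / 41209) * x + 21217681 / 824180000 * y)
    + (x + 4 * y - (23 / 5) * x ^ 2 * y - 5 * y ^ 3 - (1 / 5) * x * y ^ 3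
        - (2 / 15) * y ^ 4 + x ^ 4 * y + 2 * x ^ 2 * y ^ 3 + y ^ 5)
      * (21217681 / 824180000 * x + 2 * (-1385007837710472239 / 1318688000000000000) * y)
    = -y ^ 2 * transversalityFactor x y + (-204156472122408166934853 / 25600000000000000000000 * y ^ 2
      + 108466867129 / 250000000000 * y ^ 3
      + 11573485471 / 15625000000 * y ^ 4
      + 747053330329 / 16000000000000 * x * y
      + 2 / 5 * x * y ^ 2
      - 154791 / 20000 * x ^ 2
      + 4 * x ^ 2 * y ^ 2
      + 2 * x ^ 4) * ellipsePoly x y := by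
  unfold transversalityFactor ellipsePoly
  ring

theorem hasFDerivAt_quadratic (A B C : ℝ) (p : ℝ × ℝ) :
    HasFDerivAt (fun q : ℝ × ℝ => 1 + A * q.1 ^ 2 + B * (q.1 * q.2) + C * q.2 ^ 2)
      ((2 * A * p.1 + B * p.2) • ContinuousLinearMap.fst ℝ ℝ ℝ
        + (B * p.1 + 2 * C * p.2) • ContinuousLinearMap.snd ℝ ℝ ℝ) p := by
  have h₁ : HasFDerivAt (fun q : ℝ × ℝ => q.1) (ContinuousLinearMap.fst ℝ ℝ ℝ) p := hasFDerivAt_fst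
  have h₂ : HasFDerivAt (fun q : ℝ × ℝ => q.2) (ContinuousLinearMap.snd ℝ ℝ ℝ) p := hasFDerivAt_snd
  refine ((((h₁.pow 2).const_mul A).const_add 1).add ((h₁.mul h₂).const_mul B)
    |>.add ((h₂.pow 2).const_mul C)).congr_fderiv ?_
  ext <;> simp <;> ring


/-- For `a₀ = 203/200`, the conic constructed by the paper's method for the quintic
system with two limit cycles is a nonempty bounded curve (an ellipse) which is
transversal: `ḟ` does not take both strictly positive and strictly negative values
on the curve, and vanishes at only finitely many of its points. -/
theorem quintic_two_cycles_ellipse_transversal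
    (a₀ : ℝ) (ha₀ : a₀ = 203 / 200)
    (f fdot P Q : ℝ × ℝ → ℝ)
    (hf : ∀ x y : ℝ, f (x, y) =
      1 - x ^ 2 / a₀ ^ 2
        + (10 * a₀ ^ 4 - 49 * a₀ ^ 2 + 40) * x * y / (5 * a₀ ^ 2)
        + (200 * a₀ ^ 8 - 1010 * a₀ ^ 6 + 147 * a₀ ^ 4 + 3800 * a₀ ^ 2 - 3300)
            * y ^ 2 / (100 * a₀ ^ 2))
    (hP : ∀ x y : ℝ, P (x, y) =
      -y + 4 * x - (49 / 10) * x ^ 3 - (26 / 5) * x * y ^ 2 + (1 / 5) * x ^ 2 * y ^ 2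
        + x ^ 5 + 2 * x ^ 3 * y ^ 2 + x * y ^ 4)
    (hQ : ∀ x y : ℝ, Q (x, y) =
      x + 4 * y - (23 / 5) * x ^ 2 * y - 5 * y ^ 3 - (1 / 5) * x * y ^ 3
        - (2 / 15) * y ^ 4 + x ^ 4 * y + 2 * x ^ 2 * y ^ 3 + y ^ 5)
    (hfdot : ∀ p : ℝ × ℝ,
      fdot p = P p * fderiv ℝ f p (1, 0) + Q p * fderiv ℝ f p (0, 1)) :
    ({p : ℝ × ℝ | f p = 0}).Nonempty ∧
    Bornology.IsBounded {p : ℝ × ℝ | f p = 0} ∧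
    ¬ ((∃ p : ℝ × ℝ, f p = 0 ∧ 0 < fdot p) ∧ (∃ p : ℝ × ℝ, f p = 0 ∧ fdot p < 0)) ∧
    Set.Finite {p : ℝ × ℝ | f p = 0 ∧ fdot p = 0} := by
  have hf' : ∀ x y : ℝ, f (x, y) = ellipsePoly x y := by
    intro x y
    rw [hf, ha₀]
    unfold ellipsePoly
    ring
  have hfun : f = fun q : ℝ × ℝ => 1 + (-40000 / 41209) * q.1 ^ 2
      + (21217681 / 824180000) * (q.1 * q.2)
      + (-1385007837710472239 / 1318688000000000000) * q.2 ^ 2 := by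
    funext ⟨x, y⟩
    rw [hf']
    unfold ellipsePoly
    ring
  have hdot : ∀ x y : ℝ, f (x, y) = 0 → fdot (x, y) = -y ^ 2 * transversalityFactor x y := by
    intro x y h
    have hd := (hasFDerivAt_quadratic (-40000 / 41209) (21217681 / 824180000)
      (-1385007837710472239 / 1318688000000000000) (x, y)).fderiv
    rw [← hfun] at hd
    have key := orbital_derivative_eq x y
    rw [← hf', h, mul_zero, add_zero] at key
    rw [hfdot, hP, hQ, hd, ← key]
    simp
  have hpos : ∀ x y : ℝ, f (x, y) = 0 → 0 < transversalityFactor x y :=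
    fun x y h => transversalityFactor_pos (hf' x y ▸ h)
  refine ⟨⟨(203 / 200, 0), ?_⟩, ?_, ?_, ?_⟩
  · rw [Set.mem_ofPred_eq, hf', ellipsePoly]
    norm_num
  · refine isBounded_iff_forall_norm_le.mpr ⟨11 / 10, ?_⟩
    rintro ⟨x, y⟩ h
    exact norm_prod_le_iff.mpr (abs_le_of_ellipsePoly_eq_zero (hf' x y ▸ h))
  · rintro ⟨⟨⟨x, y⟩, h, hlt⟩, -⟩
    rw [hdot x y h] at hlt
    nlinarith [mul_nonneg (sq_nonneg y) (hpos x y h).le]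
  · refine (Set.toFinite {((203 / 200 : ℝ), (0 : ℝ)), (-203 / 200, 0)}).subset ?_
    rintro ⟨x, y⟩ ⟨h, h₀⟩
    rw [hdot x y h] at h₀
    have hy : y = 0 := by simpa [(hpos x y h).ne'] using h₀
    subst hy
    rw [hf', ellipsePoly] at h
    have hx : (x - 203 / 200) * (x + 203 / 200) = 0 := by linear_combination -(41209 / 40000) * h
    rcases mul_eq_zero.mp hx with hx | hx
    · left
      rw [sub_eq_zero.mp hx]
    · right
      rw [Set.mem_singleton_iff, eq_neg_of_add_eq_zero_left hx, neg_div]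
end
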